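/- Let T > 0, let h ≥ 1 be an integer, let w_h ∈ W^{1,2}([0,T]; 𝔽_h), and let u_{0,h}, v_{0,h} ∈ 𝔽_h with u_{0,h} ∈ 𝔄_h(w_h(0)) and 0 ≤ v_{0,h} ≤ 1 on Ω. Then there exists a finite-dimensional quasi-static evolution (u_h, v_h) : [0,T] → 𝔽_h × 𝔽_h (with boundary datum w_h) such that u_h(0) = u_{0,h} and v_h(0) = v_{0,h}. -/

import Mathlib

open MeasureTheory Filter
open scoped Classical
open scoped RealInnerProductSpace

noncomputable section

abbrev E2 : Type := EuclideanSpace ℝ (Fin 2)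

/-- The point `(a, b) ∈ ℝ²`. -/
def vtx (a b : ℝ) : E2 := (WithLp.equiv 2 (Fin 2 → ℝ)).symm ![a, b]

/-- The open unit square `Ω = (0,1)²`. -/
def Omega : Set E2 := {x | x 0 ∈ Set.Ioo (0:ℝ) 1 ∧ x 1 ∈ Set.Ioo (0:ℝ) 1}

/-- The closed unit square `Ω̄ = [0,1]²`. -/
def OmegaCl : Set E2 := {x | x 0 ∈ Set.Icc (0:ℝ) 1 ∧ x 1 ∈ Set.Icc (0:ℝ) 1}

/-- The boundary `∂Ω = Ω̄ \ Ω`. -/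
def OmegaBd : Set E2 := OmegaCl \ Omega

/-- Lower-left triangle `K⁺_{k,j}` of the uniform triangulation `𝒯_h`. -/
def Kplus (h k j : ℕ) : Set E2 :=
  {x | ((k:ℝ)-1)/h ≤ x 0 ∧ x 0 ≤ (k:ℝ)/h ∧ ((j:ℝ)-1)/h ≤ x 1 ∧
        x 1 ≤ ((j:ℝ)-1)/h + ((k:ℝ)/h - x 0)}

/-- Upper-right triangle `K⁻_{k,j}` of the uniform triangulation `𝒯_h`. -/
def Kminus (h k j : ℕ) : Set E2 :=
  {x | ((k:ℝ)-1)/h ≤ x 0 ∧ x 0 ≤ (k:ℝ)/h ∧ (j:ℝ)/h + (((k:ℝ)-1)/h - x 0) ≤ x 1 ∧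
        x 1 ≤ (j:ℝ)/h}

/-- `u` is affine on the set `S`. -/
def IsAffineOn (u : E2 → ℝ) (S : Set E2) : Prop :=
  ∃ (b : E2) (c : ℝ), ∀ x ∈ S, u x = ⟪b, x⟫ + c

/-- Membership in the finite element space `𝔽_h`: continuous on `Ω̄` and affine on every
triangle of the uniform triangulation `𝒯_h`. -/
def MemF (h : ℕ) (u : E2 → ℝ) : Prop :=
  ContinuousOn u OmegaCl ∧
  ∀ k j : ℕ, 1 ≤ k → k ≤ h → 1 ≤ j → j ≤ h →
    IsAffineOn u (Kplus h k j) ∧ IsAffineOn u (Kminus h k j)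

/-- The set `Δ_h` of vertices of the triangulation `𝒯_h`. -/
def Delta (h : ℕ) : Set E2 :=
  {x | ∃ k j : ℕ, k ≤ h ∧ j ≤ h ∧ x = vtx ((k:ℝ)/h) ((j:ℝ)/h)}

/-- The vertex `(k/h, j/h)` of `𝒯_h`. -/
def vertexPt (h k j : ℕ) : E2 := vtx ((k:ℝ)/h) ((j:ℝ)/h)

/-- `p` is the Lagrange interpolant of `f` on `𝒯_h`: `p ∈ 𝔽_h` and `p = f` on `Δ_h`. -/
def Interpolates (h : ℕ) (f p : E2 → ℝ) : Prop :=
  MemF h p ∧ ∀ x ∈ Delta h, p x = f x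

/-- The Lagrange interpolation operator `P_h` (a choice of interpolant; it is unique on `Ω̄`). -/

noncomputable def Ph (h : ℕ) (f : E2 → ℝ) : E2 → ℝ :=
  if hf : ∃ p, Interpolates h f p then hf.choose else 0

/-- Almost-everywhere defined gradient. -/
noncomputable def grad (u : E2 → ℝ) (x : E2) : E2 := gradient u x

/-- The squared `H¹(Ω)` norm `‖u‖²_{H¹} = ∫_Ω (u² + |∇u|²)`. -/
noncomputable def H1normSq (u : E2 → ℝ) : ℝ :=
  ∫ x in Omega, ((u x)^2 + ‖grad u x‖^2)

/-- The discrete phase-field energy `J_h`. -/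
noncomputable def Jh (h : ℕ) (η : ℝ) (u v : E2 → ℝ) : ℝ :=
  (1/2) * (∫ x in Omega, ((Ph h (fun y => (v y)^2) x + η) * ‖grad u x‖^2))
  + (1/2) * (∫ x in Omega, ‖grad v x‖^2)
  + (1/2) * (∫ x in Omega, Ph h (fun y => (1 - v y)^2) x)

/-- `u ∈ 𝔄_h(w)`: `u ∈ 𝔽_h` and `u = w` on `∂Ω`. -/
def MemA (h : ℕ) (w u : E2 → ℝ) : Prop :=
  MemF h u ∧ ∀ x ∈ OmegaBd, u x = w x

/-- Convergence in `𝔽_h`, i.e. with respect to the `H¹(Ω)` norm. -/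
def TendstoF (u : ℕ → E2 → ℝ) (ub : E2 → ℝ) : Prop :=
  Tendsto (fun j => H1normSq (fun y => u j y - ub y)) atTop (nhds 0)

/-- `u` minimizes `J_h(·, v)` over `𝔄_h(w)`. -/
def IsMinU (h : ℕ) (η : ℝ) (w v u : E2 → ℝ) : Prop :=
  MemA h w u ∧ ∀ u', MemA h w u' → Jh h η u v ≤ Jh h η u' v

/-- `v` minimizes `J_h(u, ·)` over `{v ∈ 𝔽_h : v ≤ vprev on Ω}`. -/
def IsMinV (h : ℕ) (η : ℝ) (u vprev v : E2 → ℝ) : Prop :=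
  (MemF h v ∧ ∀ x ∈ Omega, v x ≤ vprev x) ∧
  ∀ v', MemF h v' → (∀ x ∈ Omega, v' x ≤ vprev x) → Jh h η u v ≤ Jh h η u v'

end

section Evolution

open Set Topology

/-- On `[0, T]`, the function `e` is the primitive of the integrable function `f`. -/
def IsPrimitiveOn (T : ℝ) (e f : ℝ → ℝ) : Prop :=
  IntegrableOn f (Icc 0 T) ∧ ∀ t ∈ Icc 0 T, e t = e 0 + ∫ s in Ioc 0 t, f s

namespace IsPrimitiveOn

variable {T : ℝ} {e f e₁ f₁ e₂ f₂ : ℝ → ℝ}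

lemma intervalIntegrable (he : IsPrimitiveOn T e f) {s t : ℝ} (hs : 0 ≤ s) (hst : s ≤ t)
    (ht : t ≤ T) : IntervalIntegrable f volume s t := by
  rw [intervalIntegrable_iff_integrableOn_Icc_of_le hst]
  exact he.1.mono_set (Icc_subset_Icc hs ht)

lemma sub_eq (he : IsPrimitiveOn T e f) {s t : ℝ} (hs : 0 ≤ s) (hst : s ≤ t) (ht : t ≤ T) :
    e t - e s = ∫ r in Ioc s t, f r := by
  rw [he.2 t ⟨hs.trans hst, ht⟩, he.2 s ⟨hs, hst.trans ht⟩,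
    ← intervalIntegral.integral_of_le hst, ← intervalIntegral.integral_of_le hs,
    ← intervalIntegral.integral_of_le (hs.trans hst),
    ← intervalIntegral.integral_add_adjacent_intervals
      (he.intervalIntegrable le_rfl hs (hst.trans ht)) (he.intervalIntegrable hs hst ht)]
  ring

lemma absolutelyContinuous (he : IsPrimitiveOn T e f) (hT : 0 ≤ T) :
    AbsolutelyContinuousOnInterval (fun t => e 0 + ∫ s in (0 : ℝ)..t, f s) 0 T := by
  have h1 := (he.intervalIntegrable le_rfl hT le_rfl).absolutelyContinuousOnInterval_intervalIntegral
    (c := 0) left_mem_uIcc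
  have h2 : AbsolutelyContinuousOnInterval (fun _ : ℝ => e 0) 0 T :=
    (LipschitzWith.const (e 0)).lipschitzOnWith.absolutelyContinuousOnInterval
  exact h2.add h1

lemma eq_intervalIntegral (he : IsPrimitiveOn T e f) {t : ℝ} (ht : t ∈ Icc 0 T) :
    e t = e 0 + ∫ s in (0 : ℝ)..t, f s := by
  rw [intervalIntegral.integral_of_le ht.1]
  exact he.2 t ht

lemma continuousOn (he : IsPrimitiveOn T e f) (hT : 0 ≤ T) : ContinuousOn e (Icc 0 T) := by
  have h := (he.absolutelyContinuous hT).continuousOn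
  rw [uIcc_of_le hT] at h
  exact h.congr fun t ht => he.eq_intervalIntegral ht

lemma integrableOn_mul (he₁ : IsPrimitiveOn T e₁ f₁) (he₂ : IsPrimitiveOn T e₂ f₂) (hT : 0 ≤ T) :
    IntegrableOn (fun t => e₁ t * f₂ t) (Icc 0 T) :=
  he₂.1.continuousOn_mul (he₁.continuousOn hT) isCompact_Icc

lemma mul (he₁ : IsPrimitiveOn T e₁ f₁) (he₂ : IsPrimitiveOn T e₂ f₂) (hT : 0 ≤ T) :
    IsPrimitiveOn T (fun t => e₁ t * e₂ t) (fun t => e₁ t * f₂ t + e₂ t * f₁ t) := by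
  refine ⟨(he₁.integrableOn_mul he₂ hT).add (he₂.integrableOn_mul he₁ hT), fun t ht => ?_⟩
  have hsub : uIcc 0 t ⊆ uIcc 0 T := by
    rw [uIcc_of_le ht.1, uIcc_of_le hT]
    exact Icc_subset_Icc le_rfl ht.2
  have key := ((he₁.absolutelyContinuous hT).mono hsub).integral_deriv_mul_eq_sub
    ((he₂.absolutelyContinuous hT).mono hsub)
  simp only [intervalIntegral.integral_same, add_zero, ← he₁.eq_intervalIntegral ht,
    ← he₂.eq_intervalIntegral ht] at key
  rw [← intervalIntegral.integral_of_le ht.1]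
  have hcongr : ∫ x in (0 : ℝ)..t, (e₁ x * f₂ x + e₂ x * f₁ x) = e₁ t * e₂ t - e₁ 0 * e₂ 0 := by
    rw [← key]
    refine intervalIntegral.integral_congr_ae ?_
    filter_upwards [(he₁.intervalIntegrable le_rfl ht.1 ht.2).ae_hasDerivAt_integral,
      (he₂.intervalIntegrable le_rfl ht.1 ht.2).ae_hasDerivAt_integral] with x h1 h2 hx
    have hx' : x ∈ uIcc 0 t := uIoc_subset_uIcc hx
    have hxT : x ∈ Icc 0 T := by
      have := hsub hx'
      rwa [uIcc_of_le hT] at this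
    rw [((h1 hx' 0 left_mem_uIcc).const_add (e₁ 0)).deriv,
      ((h2 hx' 0 left_mem_uIcc).const_add (e₂ 0)).deriv, ← he₁.eq_intervalIntegral hxT,
      ← he₂.eq_intervalIntegral hxT]
    ring
  rw [hcongr]
  ring

lemma const_mul (c : ℝ) (he : IsPrimitiveOn T e f) :
    IsPrimitiveOn T (fun t => c * e t) (fun t => c * f t) := by
  refine ⟨he.1.const_mul c, fun t ht => ?_⟩
  simp only [integral_const_mul]
  rw [he.2 t ht]
  ring

end IsPrimitiveOn

/-- Helly's selection principle for antitone curves in the unit cube. -/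
theorem exists_subseq_tendsto_of_antitone {ι : Type*} [Finite ι] (f : ℕ → ℝ → ι → ℝ)
    (hf : ∀ n, Antitone (f n)) (hf01 : ∀ n t, f n t ∈ Icc (0 : ι → ℝ) 1) :
    ∃ (φ : ℕ → ℕ) (g : ℝ → ι → ℝ), StrictMono φ ∧ Antitone g ∧ (∀ t, g t ∈ Icc (0 : ι → ℝ) 1) ∧
      ∀ t, Tendsto (fun n => f (φ n) t) atTop (𝓝 (g t)) := by
  have := Fintype.ofFinite ι
  have hlim : ∀ t, ∃ x ∈ Icc (0 : ι → ℝ) 1,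
      Tendsto (fun n => f n t) (hyperfilter ℕ : Filter ℕ) (𝓝 x) := fun t =>
    isCompact_Icc.ultrafilter_le_nhds ((hyperfilter ℕ).map fun n => f n t)
      (le_principal_iff.2 (mem_map.2 (univ_mem' fun n => hf01 n t)))
  choose g hg01 hg using hlim
  have hganti : Antitone g := fun s t hst =>
    le_of_tendsto_of_tendsto' (hg t) (hg s) fun n => hf n hst
  have hgi : ∀ i, Antitone fun t => g t i := fun i s t hst => hganti hst i
  let C : Set ℝ := (⋃ i, {t | ¬ContinuousAt (fun t => g t i) t}) ∪ range ((↑) : ℚ → ℝ)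
  have hC : C.Countable :=
    (countable_iUnion fun i => (hgi i).countable_not_continuousAt).union (countable_range _)
  have : Countable C := hC.to_subtype
  have hclus : MapClusterPt (fun c : C => g c) atTop (fun n (c : C) => f n c) := by
    have h1 : Tendsto (fun n (c : C) => f n c) (hyperfilter ℕ : Filter ℕ) (𝓝 fun c : C => g c) :=
      tendsto_pi_nhds.2 fun c => hg c
    exact h1.mapClusterPt.mono (by rw [← Nat.cofinite_eq_atTop]; exact hyperfilter_le_cofinite)
  obtain ⟨φ, hφ, hconv⟩ := hclus.tendsto_subseq
  have hconvC : ∀ c ∈ C, ∀ i, Tendsto (fun n => f (φ n) c i) atTop (𝓝 (g c i)) := fun c hc i =>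
    tendsto_pi_nhds.1 (tendsto_pi_nhds.1 hconv ⟨c, hc⟩) i
  refine ⟨φ, g, hφ, hganti, hg01, fun t => tendsto_pi_nhds.2 fun i => ?_⟩
  by_cases ht : t ∈ C
  · exact hconvC t ht i
  have hcont : ContinuousAt (fun t => g t i) t := by
    by_contra h
    exact ht (Or.inl (mem_iUnion.2 ⟨i, h⟩))
  refine tendsto_order.2 ⟨fun a ha => ?_, fun a ha => ?_⟩
  · obtain ⟨δ, hδ, hball⟩ := Metric.eventually_nhds_iff.1 (hcont.eventually (lt_mem_nhds ha))
    obtain ⟨q, hq1, hq2⟩ := exists_rat_btwn (show t < t + δ by linarith)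
    have hq : a < g q i := hball (by rw [Real.dist_eq, abs_lt]; constructor <;> linarith)
    filter_upwards [(hconvC q (Or.inr ⟨q, rfl⟩) i).eventually (lt_mem_nhds hq)] with n hn
    exact hn.trans_le (hf (φ n) hq1.le i)
  · obtain ⟨δ, hδ, hball⟩ := Metric.eventually_nhds_iff.1 (hcont.eventually (gt_mem_nhds ha))
    obtain ⟨q, hq1, hq2⟩ := exists_rat_btwn (show t - δ < t by linarith)
    have hq : g q i < a := hball (by rw [Real.dist_eq, abs_lt]; constructor <;> linarith)
    filter_upwards [(hconvC q (Or.inr ⟨q, rfl⟩) i).eventually (gt_mem_nhds hq)] with n hn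
    exact (hf (φ n) hq2.le i).trans_lt hn

section Scheme

variable {ι κ : Type*} [Fintype κ]

/-- An energy depending on time only through the coefficients `e k t`. -/
def separableEnergy (D : (ι → ℝ) → ℝ) (c : κ → (ι → ℝ) → ℝ) (e : κ → ℝ → ℝ) (t : ℝ)
    (b : ι → ℝ) : ℝ :=
  D b + ∑ k, c k b * e k t

variable {D : (ι → ℝ) → ℝ} {c : κ → (ι → ℝ) → ℝ} {e f : κ → ℝ → ℝ} {T : ℝ} {b₀ : ι → ℝ}

lemma continuous_separableEnergy (hD : Continuous D) (hc : ∀ k, Continuous (c k)) (t : ℝ) :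
    Continuous (separableEnergy D c e t) := by
  unfold separableEnergy
  fun_prop

lemma exists_isMinOn_separableEnergy (hD : Continuous D) (hc : ∀ k, Continuous (c k))
    (hpos : ∀ t b, separableEnergy D c e t (b ⊔ 0) ≤ separableEnergy D c e t b) (t : ℝ)
    (b : ι → ℝ) (hb : 0 ≤ b) :
    ∃ b₁, 0 ≤ b₁ ∧ b₁ ≤ b ∧
      ∀ b' ≤ b, separableEnergy D c e t b₁ ≤ separableEnergy D c e t b' := by
  obtain ⟨b₁, hb₁, hmin⟩ := (isCompact_Icc (a := (0 : ι → ℝ)) (b := b)).exists_isMinOn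
    ⟨0, le_rfl, hb⟩ (continuous_separableEnergy (e := e) hD hc t).continuousOn
  exact ⟨b₁, hb₁.1, hb₁.2, fun d hd =>
    (hmin (show d ⊔ 0 ∈ Icc 0 b from ⟨le_sup_right, sup_le hd hb⟩)).trans (hpos t d)⟩

/-- Incremental minimization with time step `τ`. -/
lemma exists_incremental_minimizers (hD : Continuous D) (hc : ∀ k, Continuous (c k))
    (hpos : ∀ t b, separableEnergy D c e t (b ⊔ 0) ≤ separableEnergy D c e t b)
    (hb₀ : 0 ≤ b₀) (τ : ℝ) :
    ∃ B : ℕ → ι → ℝ, B 0 = b₀ ∧ Antitone B ∧ (∀ i, 0 ≤ B i) ∧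
      ∀ i : ℕ, ∀ b' ≤ B i, separableEnergy D c e ((i + 1 : ℕ) * τ) (B (i + 1)) ≤
        separableEnergy D c e ((i + 1 : ℕ) * τ) b' := by
  choose next h0 hle hmin using exists_isMinOn_separableEnergy (e := e) hD hc hpos
  let B : ℕ → {b : ι → ℝ // 0 ≤ b} := fun n => Nat.rec ⟨b₀, hb₀⟩
    (fun i b => ⟨next ((i + 1 : ℕ) * τ) b.1 b.2, h0 _ _ _⟩) n
  exact ⟨fun i => (B i).1, rfl, antitone_nat_of_succ_le fun i => hle _ _ _, fun i => (B i).2,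
    fun i => hmin _ _ _⟩

lemma exists_bound_of_continuous {g : (ι → ℝ) → ℝ} (hg : Continuous g) :
    ∃ M, ∀ b ∈ Icc (0 : ι → ℝ) 1, ‖g b‖ ≤ M :=
  isCompact_Icc.exists_bound_of_continuousOn hg.continuousOn

lemma integrableOn_power [Finite ι] (hc : ∀ k, Continuous (c k)) (he : ∀ k, IsPrimitiveOn T (e k) (f k))
    {b : ℝ → ι → ℝ} (hb : Measurable b) (hb01 : ∀ s, b s ∈ Icc (0 : ι → ℝ) 1) :
    IntegrableOn (fun s => ∑ k, c k (b s) * f k s) (Icc 0 T) := by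
  refine integrable_finsetSum _ fun k _ => ?_
  obtain ⟨M, hM⟩ := exists_bound_of_continuous (hc k)
  exact (he k).1.bdd_mul ((hc k).measurable.comp hb).aestronglyMeasurable
    (Eventually.of_forall fun s => hM _ (hb01 s))

lemma separableEnergy_sub (he : ∀ k, IsPrimitiveOn T (e k) (f k)) {s t : ℝ} (hs : 0 ≤ s)
    (hst : s ≤ t) (ht : t ≤ T) (b : ι → ℝ) :
    separableEnergy D c e t b =
      separableEnergy D c e s b + ∫ r in Ioc s t, ∑ k, c k b * f k r := by
  rw [integral_finsetSum _ fun k _ => Integrable.const_mul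
    ((he k).1.mono_set (Ioc_subset_Icc_self.trans (Icc_subset_Icc hs ht))) _]
  simp only [integral_const_mul, ← (he _).sub_eq hs hst ht, separableEnergy, mul_sub,
    Finset.sum_sub_distrib]
  ring

lemma incremental_energy_le [Finite ι] (hc : ∀ k, Continuous (c k))
    (he : ∀ k, IsPrimitiveOn T (e k) (f k)) {τ : ℝ} (hτ : 0 < τ) {B : ℕ → ι → ℝ}
    (hB01 : ∀ i, B i ∈ Icc (0 : ι → ℝ) 1)
    (hmin : ∀ i : ℕ, separableEnergy D c e ((i + 1 : ℕ) * τ) (B (i + 1)) ≤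
        separableEnergy D c e ((i + 1 : ℕ) * τ) (B i)) (i : ℕ) :
    ∀ t, i * τ ≤ t → t ≤ (i + 1 : ℕ) * τ → t ≤ T →
      separableEnergy D c e t (B i) ≤ separableEnergy D c e 0 (B 0) +
        ∫ s in Ioc 0 t, ∑ k, c k (B ⌊s / τ⌋₊) * f k s := by
  have hmeas : Measurable fun s => B ⌊s / τ⌋₊ :=
    (measurable_from_nat (f := B)).comp (Nat.measurable_floor.comp (measurable_id.div_const τ))
  have hint := integrableOn_power hc he hmeas fun s => hB01 _
  have hstep : ∀ (i : ℕ) t, i * τ ≤ t → t ≤ (i + 1 : ℕ) * τ → t ≤ T →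
      separableEnergy D c e t (B i) = separableEnergy D c e (i * τ) (B i) +
        ∫ s in Ioc (i * τ) t, ∑ k, c k (B ⌊s / τ⌋₊) * f k s := by
    intro i t h1 h2 h3
    rw [separableEnergy_sub he (by positivity) h1 h3, integral_Ioc_eq_integral_Ioo,
      integral_Ioc_eq_integral_Ioo]
    congr 1
    refine setIntegral_congr_fun measurableSet_Ioo fun s hs => ?_
    have hfl : ⌊s / τ⌋₊ = i := by
      rw [Nat.floor_eq_iff (div_nonneg (le_trans (by positivity) hs.1.le) hτ.le),
        le_div_iff₀ hτ, div_lt_iff₀ hτ]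
      refine ⟨hs.1.le, ?_⟩
      have := hs.2.trans_le h2
      push_cast at this
      exact this
    simp only [hfl]
  induction i with
  | zero =>
    intro t h1 h2 h3
    rw [hstep 0 t h1 h2 h3]
    simp
  | succ i ih =>
    intro t h1 h2 h3
    have hi0 : (0 : ℝ) ≤ (i + 1 : ℕ) * τ := by positivity
    have hprev := ih ((i + 1 : ℕ) * τ) (by gcongr; simp) le_rfl (h1.trans h3)
    have hsplit : (∫ s in Ioc 0 t, ∑ k, c k (B ⌊s / τ⌋₊) * f k s) =
        (∫ s in Ioc 0 ((i + 1 : ℕ) * τ), ∑ k, c k (B ⌊s / τ⌋₊) * f k s) +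
        ∫ s in Ioc ((i + 1 : ℕ) * τ) t, ∑ k, c k (B ⌊s / τ⌋₊) * f k s := by
      rw [← Ioc_union_Ioc_eq_Ioc hi0 h1, setIntegral_union
        (Ioc_disjoint_Ioc_of_le le_rfl) measurableSet_Ioc]
      · exact hint.mono_set (Ioc_subset_Icc_self.trans (Icc_subset_Icc le_rfl (h1.trans h3)))
      · exact hint.mono_set (Ioc_subset_Icc_self.trans (Icc_subset_Icc hi0 h3))
    rw [hstep (i + 1) t h1 h2 h3, hsplit]
    linarith [hmin i]

/-- Existence of evolutions of unilateral global minimizers for an energy whose time dependence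
is absolutely continuous. -/
theorem exists_unilateral_evolution [Finite ι] (hT : 0 < T) (hD : Continuous D)
    (hc : ∀ k, Continuous (c k)) (he : ∀ k, IsPrimitiveOn T (e k) (f k))
    (hpos : ∀ t b, separableEnergy D c e t (b ⊔ 0) ≤ separableEnergy D c e t b)
    (hb₀ : b₀ ∈ Icc (0 : ι → ℝ) 1) :
    ∃ b : ℝ → ι → ℝ, b 0 = b₀ ∧ Antitone b ∧ (∀ t, b t ∈ Icc (0 : ι → ℝ) 1) ∧
      (∀ t ∈ Ioc 0 T, ∀ b' ≤ b t, separableEnergy D c e t (b t) ≤ separableEnergy D c e t b') ∧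
      ∀ t ∈ Icc 0 T, separableEnergy D c e t (b t) ≤ separableEnergy D c e 0 b₀ +
        ∫ s in Ioc 0 t, ∑ k, c k (b s) * f k s := by
  let τ : ℕ → ℝ := fun n => T / (n + 1)
  have hτ : ∀ n, 0 < τ n := fun n => by positivity
  have hτ0 : Tendsto τ atTop (𝓝 0) := tendsto_const_div_atTop_nhds_zero_nat T |>.comp
    (tendsto_add_atTop_nat 1) |>.congr fun n => by simp [τ]
  choose B hB0 hBanti hBpos hBmin using fun n =>
    exists_incremental_minimizers (e := e) hD hc hpos hb₀.1 (τ n)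
  have hB01 : ∀ n i, B n i ∈ Icc (0 : ι → ℝ) 1 := fun n i =>
    ⟨hBpos n i, (hBanti n (Nat.zero_le i)).trans ((hB0 n).le.trans hb₀.2)⟩
  let v : ℕ → ℝ → ι → ℝ := fun n t => B n ⌊t / τ n⌋₊
  have hvanti : ∀ n, Antitone (v n) := fun n s t hst =>
    hBanti n (Nat.floor_mono (div_le_div_of_nonneg_right hst (hτ n).le))
  obtain ⟨φ, b, hφ, hbanti, hb01, hb⟩ :=
    exists_subseq_tendsto_of_antitone v hvanti fun n t => hB01 n _
  have hτφ : Tendsto (fun n => τ (φ n)) atTop (𝓝 0) := hτ0.comp hφ.tendsto_atTop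
  refine ⟨b, ?_, hbanti, hb01, ?_, ?_⟩
  · refine tendsto_nhds_unique (hb 0) ?_
    simp [v, hB0]
  · intro t ht b' hb'
    let i : ℕ → ℕ := fun n => ⌊t / τ (φ n)⌋₊
    let tn : ℕ → ℝ := fun n => i n * τ (φ n)
    have htn : ∀ n, tn n ≤ t := fun n => by
      rw [← le_div_iff₀ (hτ _)]
      exact Nat.floor_le (div_nonneg ht.1.le (hτ _).le)
    have htn0 : ∀ n, 0 ≤ tn n := fun n => mul_nonneg (Nat.cast_nonneg _) (hτ _).le
    have htn' : ∀ n, t - τ (φ n) ≤ tn n := fun n => by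
      have := (div_lt_iff₀ (hτ (φ n))).1 (Nat.lt_floor_add_one (t / τ (φ n)))
      simp only [tn, i]
      linarith
    have htlim : Tendsto tn atTop (𝓝 t) := by
      refine tendsto_of_tendsto_of_tendsto_of_le_of_le ?_ tendsto_const_nhds htn' htn
      simpa using tendsto_const_nhds.sub hτφ
    have helim : ∀ k, Tendsto (fun n => e k (tn n)) atTop (𝓝 (e k t)) := fun k =>
      (((he k).continuousOn hT.le) t ⟨ht.1.le, ht.2⟩).tendsto.comp
        (tendsto_nhdsWithin_iff.2 ⟨htlim, Eventually.of_forall fun n =>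
          ⟨htn0 n, (htn n).trans ht.2⟩⟩)
    have hElim : ∀ (y : ℕ → ι → ℝ) (y' : ι → ℝ), Tendsto y atTop (𝓝 y') →
        Tendsto (fun n => separableEnergy D c e (tn n) (y n)) atTop
          (𝓝 (separableEnergy D c e t y')) := fun y y' hy =>
      ((hD.tendsto y').comp hy).add (tendsto_finsetSum _ fun k _ =>
        (((hc k).tendsto y').comp hy).mul (helim k))
    have hcomp : Tendsto (fun n => b' + (v (φ n) t - b t)) atTop (𝓝 b') := by
      simpa using tendsto_const_nhds (x := b').add ((hb t).sub (tendsto_const_nhds (x := b t)))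
    refine le_of_tendsto_of_tendsto (hElim _ _ (hb t)) (hElim _ _ hcomp) ?_
    filter_upwards [hτφ.eventually (gt_mem_nhds ht.1)] with n hn
    have hi : 1 ≤ i n := by
      rw [Nat.le_floor_iff (div_nonneg ht.1.le (hτ _).le), le_div_iff₀ (hτ _)]
      simpa using hn.le
    obtain ⟨m, hm⟩ : ∃ m, i n = m + 1 := ⟨i n - 1, by omega⟩
    have hle : b' + (v (φ n) t - b t) ≤ v (φ n) t := fun j => by
      have := hb' j
      simp only [Pi.add_apply, Pi.sub_apply]
      linarith
    have h := hBmin (φ n) m (b' + (v (φ n) t - b t))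
      (hle.trans (hBanti (φ n) (by simp only [i] at hm; omega)))
    rw [← hm] at h
    exact h
  · intro t ht
    have hdom : Tendsto (fun n => ∫ s in Ioc 0 t, ∑ k, c k (v (φ n) s) * f k s) atTop
        (𝓝 (∫ s in Ioc 0 t, ∑ k, c k (b s) * f k s)) := by
      choose M hM using fun k => exists_bound_of_continuous (hc k)
      have hsub : Ioc 0 t ⊆ Icc 0 T := Ioc_subset_Icc_self.trans (Icc_subset_Icc le_rfl ht.2)
      refine tendsto_integral_of_dominated_convergence (fun s => ∑ k, M k * ‖f k s‖) ?_ ?_ ?_ ?_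
      · intro n
        have hmeas : Measurable (v (φ n)) := (measurable_from_nat (f := B (φ n))).comp
          (Nat.measurable_floor.comp (measurable_id.div_const _))
        exact ((integrableOn_power hc he hmeas fun s => hB01 _ _).mono_set hsub).1
      · exact integrable_finsetSum _ fun k _ => (((he k).1.mono_set hsub).norm).const_mul _
      · refine fun n => Eventually.of_forall fun s => (norm_sum_le _ _).trans ?_
        refine Finset.sum_le_sum fun k _ => ?_
        rw [norm_mul]
        exact mul_le_mul_of_nonneg_right (hM k _ (hB01 _ _)) (norm_nonneg _)
      · exact Eventually.of_forall fun s => tendsto_finsetSum _ fun k _ =>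
          (((hc k).tendsto _).comp (hb s)).mul_const _
    refine le_of_tendsto_of_tendsto'
      (((continuous_separableEnergy hD hc t).tendsto _).comp (hb t))
      (tendsto_const_nhds.add hdom) fun n => ?_
    have h := incremental_energy_le hc he (hτ (φ n)) (hB01 (φ n))
      (fun i => hBmin (φ n) i _ le_rfl) ⌊t / τ (φ n)⌋₊ t ?_ ?_ ht.2
    · rw [hB0] at h
      exact h
    · rw [← le_div_iff₀ (hτ _)]
      exact Nat.floor_le (div_nonneg ht.1 (hτ _).le)
    · rw [← div_le_iff₀ (hτ _)]
      push_cast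
      exact (Nat.lt_floor_add_one _).le

end Scheme

end Evolution

section Dirichlet

open Set Topology Matrix

variable {ι : Type*} [Fintype ι]

/-- The linear system for minimizers of `Q` with prescribed values on the index set `bd`. -/
noncomputable def dirichletMatrix (bd : Set ι) (Q : Matrix ι ι ℝ) : Matrix ι ι ℝ :=
  Matrix.of fun i j => if i ∈ bd then (1 : Matrix ι ι ℝ) i j else Q i j

/-- The matrix mapping boundary data to the minimizer of the quadratic form `Q`. -/
noncomputable def dirichletSolution (bd : Set ι) (Q : Matrix ι ι ℝ) : Matrix ι ι ℝ :=
  (dirichletMatrix bd Q)⁻¹ * Matrix.diagonal (bd.indicator 1)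

variable {bd : Set ι} {Q : Matrix ι ι ℝ}

lemma dirichletMatrix_mulVec_of_mem {i : ι} (hi : i ∈ bd) (a : ι → ℝ) :
    (dirichletMatrix bd Q *ᵥ a) i = a i := by
  have h : (dirichletMatrix bd Q *ᵥ a) i = ((1 : Matrix ι ι ℝ) *ᵥ a) i := by
    simp only [mulVec, dotProduct, dirichletMatrix, Matrix.of_apply, if_pos hi]
  rw [h, one_mulVec]

lemma dirichletMatrix_mulVec_of_notMem {i : ι} (hi : i ∉ bd) (a : ι → ℝ) :
    (dirichletMatrix bd Q *ᵥ a) i = (Q *ᵥ a) i := by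
  simp only [mulVec, dotProduct, dirichletMatrix, Matrix.of_apply, if_neg hi]

lemma dotProduct_eq_zero_of_complementary {a z : ι → ℝ} (hz : ∀ i ∈ bd, z i = 0)
    (ha : ∀ i ∉ bd, a i = 0) : z ⬝ᵥ a = 0 := by
  refine Finset.sum_eq_zero fun i _ => ?_
  by_cases hi : i ∈ bd
  · rw [hz i hi, zero_mul]
  · rw [ha i hi, mul_zero]

lemma isUnit_det_dirichletMatrix
    (hdef : ∀ z : ι → ℝ, (∀ i ∈ bd, z i = 0) → z ⬝ᵥ Q *ᵥ z = 0 → z = 0) :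
    IsUnit (dirichletMatrix bd Q).det := by
  rw [isUnit_iff_ne_zero, Ne, ← Matrix.exists_mulVec_eq_zero_iff]
  rintro ⟨z, hz0, hz⟩
  have hzbd : ∀ i ∈ bd, z i = 0 := fun i hi => by
    rw [← dirichletMatrix_mulVec_of_mem (Q := Q) hi z, hz, Pi.zero_apply]
  refine hz0 (hdef z hzbd (dotProduct_eq_zero_of_complementary hzbd fun i hi => ?_))
  rw [← dirichletMatrix_mulVec_of_notMem hi z, hz, Pi.zero_apply]

lemma dirichletMatrix_mulVec_solution
    (hdef : ∀ z : ι → ℝ, (∀ i ∈ bd, z i = 0) → z ⬝ᵥ Q *ᵥ z = 0 → z = 0) (g : ι → ℝ) :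
    dirichletMatrix bd Q *ᵥ (dirichletSolution bd Q *ᵥ g) = bd.indicator g := by
  rw [dirichletSolution, mulVec_mulVec, mul_nonsing_inv_cancel_left _ _
    (isUnit_det_dirichletMatrix hdef)]
  ext i
  rw [mulVec_diagonal]
  by_cases hi : i ∈ bd <;> simp [hi]

lemma dirichletSolution_mulVec_of_mem
    (hdef : ∀ z : ι → ℝ, (∀ i ∈ bd, z i = 0) → z ⬝ᵥ Q *ᵥ z = 0 → z = 0) (g : ι → ℝ)
    {i : ι} (hi : i ∈ bd) : (dirichletSolution bd Q *ᵥ g) i = g i := by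
  rw [← dirichletMatrix_mulVec_of_mem (Q := Q) hi (dirichletSolution bd Q *ᵥ g),
    dirichletMatrix_mulVec_solution hdef,
    indicator_of_mem hi]

lemma mulVec_dirichletSolution_of_notMem
    (hdef : ∀ z : ι → ℝ, (∀ i ∈ bd, z i = 0) → z ⬝ᵥ Q *ᵥ z = 0 → z = 0) (g : ι → ℝ)
    {i : ι} (hi : i ∉ bd) : (Q *ᵥ (dirichletSolution bd Q *ᵥ g)) i = 0 := by
  rw [← dirichletMatrix_mulVec_of_notMem hi, dirichletMatrix_mulVec_solution hdef,
    indicator_of_notMem hi]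

/-- The Euler-Lagrange equation. -/
lemma dotProduct_mulVec_dirichletSolution_eq
    (hdef : ∀ z : ι → ℝ, (∀ i ∈ bd, z i = 0) → z ⬝ᵥ Q *ᵥ z = 0 → z = 0) (g : ι → ℝ)
    {a a' : ι → ℝ} (haa' : ∀ i ∈ bd, a i = a' i) :
    a ⬝ᵥ Q *ᵥ (dirichletSolution bd Q *ᵥ g) = a' ⬝ᵥ Q *ᵥ (dirichletSolution bd Q *ᵥ g) := by
  rw [← sub_eq_zero, ← sub_dotProduct]
  exact dotProduct_eq_zero_of_complementary (fun i hi => sub_eq_zero.2 (haa' i hi))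
    fun i hi => mulVec_dirichletSolution_of_notMem hdef g hi

lemma dotProduct_mulVec_comm (hQ : Q.IsSymm) (a a' : ι → ℝ) :
    a ⬝ᵥ Q *ᵥ a' = a' ⬝ᵥ Q *ᵥ a := by
  rw [dotProduct_mulVec, ← mulVec_transpose, hQ.eq, dotProduct_comm]

lemma dirichletSolution_isMin (hQ : Q.IsSymm) (hpsd : ∀ a : ι → ℝ, 0 ≤ a ⬝ᵥ Q *ᵥ a)
    (hdef : ∀ z : ι → ℝ, (∀ i ∈ bd, z i = 0) → z ⬝ᵥ Q *ᵥ z = 0 → z = 0) (g : ι → ℝ)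
    {a : ι → ℝ} (ha : ∀ i ∈ bd, a i = g i) :
    (dirichletSolution bd Q *ᵥ g) ⬝ᵥ Q *ᵥ (dirichletSolution bd Q *ᵥ g) ≤ a ⬝ᵥ Q *ᵥ a := by
  have h1 := dotProduct_mulVec_dirichletSolution_eq hdef g (a := a)
    (a' := dirichletSolution bd Q *ᵥ g)
    fun i hi => by rw [dirichletSolution_mulVec_of_mem hdef g hi, ha i hi]
  have h2 := hpsd (a - dirichletSolution bd Q *ᵥ g)
  rw [mulVec_sub, sub_dotProduct, dotProduct_sub, dotProduct_sub,
    dotProduct_mulVec_comm hQ (dirichletSolution bd Q *ᵥ g) a] at h2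
  linarith

lemma continuous_dirichletSolution {X : Type*} [TopologicalSpace X] {Q : X → Matrix ι ι ℝ}
    (hQ : Continuous Q)
    (hdef : ∀ x, ∀ z : ι → ℝ, (∀ i ∈ bd, z i = 0) → z ⬝ᵥ Q x *ᵥ z = 0 → z = 0) :
    Continuous fun x => dirichletSolution bd (Q x) := by
  have hM : Continuous fun x => dirichletMatrix bd (Q x) := by
    refine continuous_matrix fun i j => ?_
    by_cases hi : i ∈ bd
    · simpa [dirichletMatrix, hi] using continuous_const
    · simpa [dirichletMatrix, hi] using hQ.matrix_elem i j
  simp only [dirichletSolution, Matrix.inv_def, Ring.inverse_eq_inv']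
  exact ((hM.matrix_det.inv₀ fun x => (isUnit_det_dirichletMatrix (hdef x)).ne_zero).smul
    hM.matrix_adjugate).matrix_mul continuous_const

/-- Existence of evolutions for an energy `½ a ⬝ Q(b) a + D(b)`, quadratic in `a`, with
prescribed values of `a` on `bd` and irreversibility in `b`. -/
theorem exists_quadratic_evolution {T : ℝ} (hT : 0 < T) {D : (ι → ℝ) → ℝ}
    {Q : (ι → ℝ) → Matrix ι ι ℝ} (hD : Continuous D) (hQ : Continuous Q)
    (hsymm : ∀ b, (Q b).IsSymm) (hpsd : ∀ b, ∀ a : ι → ℝ, 0 ≤ a ⬝ᵥ Q b *ᵥ a)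
    (hdef : ∀ b, ∀ z : ι → ℝ, (∀ i ∈ bd, z i = 0) → z ⬝ᵥ Q b *ᵥ z = 0 → z = 0)
    (hDpos : ∀ b, D (b ⊔ 0) ≤ D b)
    (hQpos : ∀ b, ∀ a : ι → ℝ, a ⬝ᵥ Q (b ⊔ 0) *ᵥ a ≤ a ⬝ᵥ Q b *ᵥ a)
    {g g' : ℝ → ι → ℝ} (hg : ∀ i, IsPrimitiveOn T (fun t => g t i) (fun t => g' t i))
    {a₀ b₀ : ι → ℝ} (ha₀ : ∀ i ∈ bd, a₀ i = g 0 i) (hb₀ : b₀ ∈ Icc (0 : ι → ℝ) 1) :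
    ∃ a b : ℝ → ι → ℝ, b 0 = b₀ ∧ Antitone b ∧ (∀ t, b t ∈ Icc (0 : ι → ℝ) 1) ∧
      (∀ t, ∀ i ∈ bd, a t i = g t i) ∧
      (∀ t, ∀ a' : ι → ℝ, (∀ i ∈ bd, a' i = g t i) →
        1 / 2 * (a t ⬝ᵥ Q (b t) *ᵥ a t) + D (b t) ≤ 1 / 2 * (a' ⬝ᵥ Q (b t) *ᵥ a') + D (b t)) ∧
      (∀ t ∈ Ioc 0 T, ∀ b' ≤ b t,
        1 / 2 * (a t ⬝ᵥ Q (b t) *ᵥ a t) + D (b t) ≤ 1 / 2 * (a t ⬝ᵥ Q b' *ᵥ a t) + D b') ∧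
      ∀ t ∈ Icc 0 T, 1 / 2 * (a t ⬝ᵥ Q (b t) *ᵥ a t) + D (b t) ≤
        1 / 2 * (a₀ ⬝ᵥ Q b₀ *ᵥ a₀) + D b₀ + ∫ s in Ioc 0 t, a s ⬝ᵥ Q (b s) *ᵥ g' s := by
  let L : (ι → ℝ) → Matrix ι ι ℝ := fun b => dirichletSolution bd (Q b)
  have hL : Continuous L := continuous_dirichletSolution hQ hdef
  let S : (ι → ℝ) → Matrix ι ι ℝ := fun b => (L b)ᵀ * Q b * L b
  have hS : Continuous S := (hL.matrix_transpose.matrix_mul hQ).matrix_mul hL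
  have hSdot : ∀ b, ∀ x y : ι → ℝ, x ⬝ᵥ S b *ᵥ y = (L b *ᵥ x) ⬝ᵥ Q b *ᵥ (L b *ᵥ y) := by
    intro b x y
    simp only [S, ← mulVec_mulVec]
    rw [dotProduct_mulVec x, vecMul_transpose]
  have hSsum : ∀ b, ∀ x y : ι → ℝ, x ⬝ᵥ S b *ᵥ y = ∑ k : ι × ι, S b k.1 k.2 * (x k.1 * y k.2) := by
    intro b x y
    simp only [dotProduct, mulVec, Fintype.sum_prod_type, Finset.mul_sum]
    exact Finset.sum_congr rfl fun i _ => Finset.sum_congr rfl fun j _ => by ring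
  have hSsymm : ∀ b, ∀ x y : ι → ℝ, x ⬝ᵥ S b *ᵥ y = y ⬝ᵥ S b *ᵥ x := fun b x y => by
    rw [hSdot, hSdot, dotProduct_mulVec_comm (hsymm b)]
  let c : ι × ι → (ι → ℝ) → ℝ := fun k b => S b k.1 k.2
  let e : ι × ι → ℝ → ℝ := fun k t => 1 / 2 * (g t k.1 * g t k.2)
  let f : ι × ι → ℝ → ℝ := fun k t => 1 / 2 * (g t k.1 * g' t k.2 + g t k.2 * g' t k.1)
  have hE : ∀ t b, separableEnergy D c e t b =
      1 / 2 * ((L b *ᵥ g t) ⬝ᵥ Q b *ᵥ (L b *ᵥ g t)) + D b := by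
    intro t b
    rw [← hSdot, hSsum, separableEnergy, Finset.mul_sum, add_comm]
    exact congrArg (· + D b) (Finset.sum_congr rfl fun k _ => by simp only [c, e]; ring)
  have hF : ∀ s b, ∑ k, c k b * f k s = (L b *ᵥ g s) ⬝ᵥ Q b *ᵥ g' s := by
    intro s b
    have h1 : ∑ k, c k b * f k s = 1 / 2 * (g s ⬝ᵥ S b *ᵥ g' s) + 1 / 2 * (g' s ⬝ᵥ S b *ᵥ g s) := by
      rw [hSsum, hSsum, Finset.mul_sum, Finset.mul_sum, ← Finset.sum_add_distrib]
      exact Finset.sum_congr rfl fun k _ => by simp only [c, f]; ring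
    rw [h1, hSsymm b (g s), hSdot, dotProduct_mulVec_comm (hsymm b) (L b *ᵥ g s) (g' s),
      dotProduct_mulVec_dirichletSolution_eq (hdef b) (g s) (a := L b *ᵥ g' s) (a' := g' s)
        fun i hi => dirichletSolution_mulVec_of_mem (hdef b) _ hi]
    ring
  have hLmin : ∀ t b, ∀ a' : ι → ℝ, (∀ i ∈ bd, a' i = g t i) →
      1 / 2 * ((L b *ᵥ g t) ⬝ᵥ Q b *ᵥ (L b *ᵥ g t)) + D b ≤ 1 / 2 * (a' ⬝ᵥ Q b *ᵥ a') + D b := by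
    intro t b a' ha'
    have := dirichletSolution_isMin (hsymm b) (hpsd b) (hdef b) (g t) ha'
    simp only [L]
    linarith
  have hLbd : ∀ t b, ∀ i ∈ bd, (L b *ᵥ g t) i = g t i := fun t b i hi =>
    dirichletSolution_mulVec_of_mem (hdef b) _ hi
  obtain ⟨b, hb0, hbanti, hb01, hstab, hen⟩ := exists_unilateral_evolution (D := D) (c := c)
    (e := e) (f := f) hT hD (fun k => hS.matrix_elem k.1 k.2)
    (fun k => ((hg k.1).mul (hg k.2) hT.le).const_mul (1 / 2))
    (fun t b => by
      rw [hE, hE]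
      refine (hLmin t (b ⊔ 0) (L b *ᵥ g t) (hLbd t b)).trans ?_
      linarith [hDpos b, hQpos b (L b *ᵥ g t)]) hb₀
  refine ⟨fun t => L (b t) *ᵥ g t, b, hb0, hbanti, hb01, fun t => hLbd t (b t),
    fun t => hLmin t (b t), fun t ht b' hb' => ?_, fun t ht => ?_⟩
  · have h := hstab t ht b' hb'
    rw [hE, hE] at h
    exact h.trans (hLmin t b' _ (hLbd t (b t)))
  · have h := hen t ht
    simp only [hE, hF] at h
    exact h.trans (add_le_add_left (hLmin 0 b₀ a₀ ha₀) _)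

end Dirichlet

section FiniteElements

open Set Topology

@[simp] lemma vtx_zero (a b : ℝ) : vtx a b 0 = a := rfl

@[simp] lemma vtx_one (a b : ℝ) : vtx a b 1 = b := rfl

lemma E2_inner (x y : E2) : ⟪x, y⟫ = x 0 * y 0 + x 1 * y 1 := by
  simp [PiLp.inner_apply, Fin.sum_univ_two, mul_comm]

lemma E2_norm_sq (x : E2) : ‖x‖ ^ 2 = x 0 ^ 2 + x 1 ^ 2 := by
  rw [← real_inner_self_eq_norm_sq, E2_inner]
  ring

/-! ### Triangles in scaled coordinates -/

variable {h : ℕ}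

lemma mem_Kplus_iff (hh : 1 ≤ h) (k j : ℕ) (x : E2) :
    x ∈ Kplus h (k + 1) (j + 1) ↔
      (k : ℝ) ≤ h * x 0 ∧ (j : ℝ) ≤ h * x 1 ∧ h * x 0 + h * x 1 ≤ k + j + 1 := by
  have h0 : (0 : ℝ) < h := by exact_mod_cast hh
  simp only [Kplus, mem_ofPred_eq, Nat.cast_add, Nat.cast_one, add_sub_cancel_right]
  rw [div_le_iff₀' h0, le_div_iff₀' h0, div_le_iff₀' h0,
    ← mul_le_mul_iff_of_pos_left h0 (b := x 1)]
  have : (h : ℝ) * ((j : ℝ) / h + (((k : ℝ) + 1) / h - x 0)) = j + (k + 1) - h * x 0 := by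
    field_simp
    ring
  rw [this]
  constructor
  · rintro ⟨h1, h2, h3, h4⟩
    exact ⟨h1, h3, by linarith⟩
  · rintro ⟨h1, h2, h3⟩
    exact ⟨h1, by linarith, h2, by linarith⟩

lemma mem_Kminus_iff (hh : 1 ≤ h) (k j : ℕ) (x : E2) :
    x ∈ Kminus h (k + 1) (j + 1) ↔
      h * x 0 ≤ k + 1 ∧ h * x 1 ≤ j + 1 ∧ (k : ℝ) + j + 1 ≤ h * x 0 + h * x 1 := by
  have h0 : (0 : ℝ) < h := by exact_mod_cast hh
  simp only [Kminus, mem_ofPred_eq, Nat.cast_add, Nat.cast_one, add_sub_cancel_right]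
  rw [div_le_iff₀' h0, le_div_iff₀' h0, le_div_iff₀' h0,
    ← mul_le_mul_iff_of_pos_left h0 (c := x 1)]
  have : (h : ℝ) * (((j : ℝ) + 1) / h + ((k : ℝ) / h - x 0)) = j + 1 + k - h * x 0 := by
    field_simp
    ring
  rw [this]
  constructor
  · rintro ⟨h1, h2, h3, h4⟩
    exact ⟨h2, h4, by linarith⟩
  · rintro ⟨h1, h2, h3⟩
    exact ⟨by linarith, h1, by linarith, h2⟩

lemma convex_Kplus (hh : 1 ≤ h) (k j : ℕ) : Convex ℝ (Kplus h (k + 1) (j + 1)) := by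
  intro x hx y hy a b ha hb hab
  rw [mem_Kplus_iff hh] at *
  simp only [PiLp.add_apply, PiLp.smul_apply, smul_eq_mul]
  obtain rfl : b = 1 - a := by linarith
  refine ⟨?_, ?_, ?_⟩ <;> nlinarith

lemma convex_Kminus (hh : 1 ≤ h) (k j : ℕ) : Convex ℝ (Kminus h (k + 1) (j + 1)) := by
  intro x hx y hy a b ha hb hab
  rw [mem_Kminus_iff hh] at *
  simp only [PiLp.add_apply, PiLp.smul_apply, smul_eq_mul]
  obtain rfl : b = 1 - a := by linarith
  refine ⟨?_, ?_, ?_⟩ <;> nlinarith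

lemma exists_cell {r : ℝ} (hh : 1 ≤ h) (hr : r ∈ Icc (0 : ℝ) 1) :
    ∃ k < h, (k : ℝ) ≤ h * r ∧ h * r ≤ k + 1 := by
  have h0 : (0 : ℝ) < h := by exact_mod_cast hh
  have hpos : 0 ≤ h * r := mul_nonneg h0.le hr.1
  by_cases hlt : ⌊h * r⌋₊ < h
  · exact ⟨⌊h * r⌋₊, hlt, Nat.floor_le hpos, (Nat.lt_floor_add_one _).le⟩
  · have h1 : (h : ℝ) ≤ h * r := (Nat.le_floor_iff hpos).1 (not_lt.1 hlt)
    have h2 : ((h - 1 : ℕ) : ℝ) = h - 1 := by push_cast [hh]; ring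
    exact ⟨h - 1, by omega, by rw [h2]; linarith, by rw [h2]; nlinarith [hr.2]⟩

lemma exists_triangle (hh : 1 ≤ h) {x : E2} (hx : x ∈ OmegaCl) :
    ∃ k < h, ∃ j < h, x ∈ Kplus h (k + 1) (j + 1) ∨ x ∈ Kminus h (k + 1) (j + 1) := by
  obtain ⟨k, hk, hk1, hk2⟩ := exists_cell hh hx.1
  obtain ⟨j, hj, hj1, hj2⟩ := exists_cell hh hx.2
  refine ⟨k, hk, j, hj, ?_⟩
  rw [mem_Kplus_iff hh, mem_Kminus_iff hh]
  rcases le_total (h * x 0 + h * x 1) (k + j + 1) with hs | hs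
  · exact Or.inl ⟨hk1, hj1, hs⟩
  · exact Or.inr ⟨hk2, hj2, hs⟩

lemma mul_vertexPt_zero (hh : 1 ≤ h) (k j : ℕ) : (h : ℝ) * vertexPt h k j 0 = k := by
  have h0 : (0 : ℝ) < h := by exact_mod_cast hh
  simp only [vertexPt, vtx_zero]
  field_simp

lemma mul_vertexPt_one (hh : 1 ≤ h) (k j : ℕ) : (h : ℝ) * vertexPt h k j 1 = j := by
  have h0 : (0 : ℝ) < h := by exact_mod_cast hh
  simp only [vertexPt, vtx_one]
  field_simp

lemma vertices_mem_Kplus (hh : 1 ≤ h) (k j : ℕ) :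
    vertexPt h k j ∈ Kplus h (k + 1) (j + 1) ∧ vertexPt h (k + 1) j ∈ Kplus h (k + 1) (j + 1) ∧
      vertexPt h k (j + 1) ∈ Kplus h (k + 1) (j + 1) := by
  simp only [mem_Kplus_iff hh, mul_vertexPt_zero hh, mul_vertexPt_one hh]
  push_cast
  refine ⟨⟨?_, ?_, ?_⟩, ⟨?_, ?_, ?_⟩, ⟨?_, ?_, ?_⟩⟩ <;> linarith

lemma vertices_mem_Kminus (hh : 1 ≤ h) (k j : ℕ) :
    vertexPt h (k + 1) (j + 1) ∈ Kminus h (k + 1) (j + 1) ∧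
      vertexPt h (k + 1) j ∈ Kminus h (k + 1) (j + 1) ∧
      vertexPt h k (j + 1) ∈ Kminus h (k + 1) (j + 1) := by
  simp only [mem_Kminus_iff hh, mul_vertexPt_zero hh, mul_vertexPt_one hh]
  push_cast
  refine ⟨⟨?_, ?_, ?_⟩, ⟨?_, ?_, ?_⟩, ⟨?_, ?_, ?_⟩⟩ <;> linarith

/-! ### Affine functions on a triangle -/

lemma IsAffineOn.eqOn_Kplus (hh : 1 ≤ h) {k j : ℕ} {u : E2 → ℝ}
    (hu : IsAffineOn u (Kplus h (k + 1) (j + 1))) {x : E2} (hx : x ∈ Kplus h (k + 1) (j + 1)) :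
    u x = (1 - (h * x 0 - k) - (h * x 1 - j)) * u (vertexPt h k j) +
      (h * x 0 - k) * u (vertexPt h (k + 1) j) + (h * x 1 - j) * u (vertexPt h k (j + 1)) := by
  have h0 : (0 : ℝ) < h := by exact_mod_cast hh
  obtain ⟨b, c, hbc⟩ := hu
  obtain ⟨v1, v2, v3⟩ := vertices_mem_Kplus hh k j
  rw [hbc x hx, hbc _ v1, hbc _ v2, hbc _ v3]
  simp only [E2_inner, vertexPt, vtx_zero, vtx_one, Nat.cast_add, Nat.cast_one]
  field_simp
  ring

lemma IsAffineOn.eqOn_Kminus (hh : 1 ≤ h) {k j : ℕ} {u : E2 → ℝ}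
    (hu : IsAffineOn u (Kminus h (k + 1) (j + 1))) {x : E2} (hx : x ∈ Kminus h (k + 1) (j + 1)) :
    u x = (1 - (k + 1 - h * x 0) - (j + 1 - h * x 1)) * u (vertexPt h (k + 1) (j + 1)) +
      (k + 1 - h * x 0) * u (vertexPt h k (j + 1)) +
      (j + 1 - h * x 1) * u (vertexPt h (k + 1) j) := by
  have h0 : (0 : ℝ) < h := by exact_mod_cast hh
  obtain ⟨b, c, hbc⟩ := hu
  obtain ⟨v1, v2, v3⟩ := vertices_mem_Kminus hh k j
  rw [hbc x hx, hbc _ v1, hbc _ v2, hbc _ v3]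
  simp only [E2_inner, vertexPt, vtx_zero, vtx_one, Nat.cast_add, Nat.cast_one]
  field_simp
  ring

lemma inner_grad_eq_sub {u : E2 → ℝ} {S : Set E2} (hS : Convex ℝ S) (hu : IsAffineOn u S)
    {x y : E2} (hx : x ∈ S) (hy : y ∈ S) (hd : DifferentiableAt ℝ u x) :
    ⟪grad u x, y - x⟫ = u y - u x := by
  obtain ⟨b, c, hbc⟩ := hu
  have hfd : ⟪grad u x, y - x⟫ = fderiv ℝ u x (y - x) := by
    simp [grad, gradient]
  have hline : HasDerivAt (fun τ : ℝ => u (x + τ • (y - x))) (fderiv ℝ u x (y - x)) 0 := by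
    have h1 : HasDerivAt (fun τ : ℝ => x + τ • (y - x)) (y - x) 0 := by
      simpa using ((hasDerivAt_id (0 : ℝ)).smul_const (y - x)).const_add x
    have h2 : HasFDerivAt u (fderiv ℝ u x) (x + (0 : ℝ) • (y - x)) := by
      simpa using hd.hasFDerivAt
    exact h2.comp_hasDerivAt 0 h1
  have hlin : HasDerivWithinAt (fun τ : ℝ => u (x + τ • (y - x))) (u y - u x) (Icc 0 1) 0 := by
    have h1 : HasDerivAt (fun τ : ℝ => u x + τ * (u y - u x)) (u y - u x) 0 := by
      simpa using ((hasDerivAt_id (0 : ℝ)).mul_const (u y - u x)).const_add (u x)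
    have heq : ∀ τ ∈ Icc (0 : ℝ) 1, u (x + τ • (y - x)) = u x + τ * (u y - u x) := by
      intro τ hτ
      rw [hbc _ (hS.add_smul_sub_mem hx hy hτ), hbc x hx, hbc y hy]
      simp only [inner_add_right, inner_smul_right, inner_sub_right]
      ring
    exact h1.hasDerivWithinAt.congr heq (heq 0 (by simp))
  rw [hfd]
  exact ((uniqueDiffOn_Icc_zero_one 0 (by simp)).eq_deriv _ hline.hasDerivWithinAt hlin)

lemma mul_inner_vertexPt_sub_horizontal (hh : 1 ≤ h) (p : E2) (k j : ℕ) :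
    (h : ℝ) * ⟪p, vertexPt h (k + 1) j - vertexPt h k j⟫ = p 0 := by
  have h0 : (0 : ℝ) < h := by exact_mod_cast hh
  simp only [E2_inner, vertexPt, PiLp.sub_apply, vtx_zero, vtx_one, Nat.cast_add, Nat.cast_one]
  field_simp
  ring

lemma mul_inner_vertexPt_sub_vertical (hh : 1 ≤ h) (p : E2) (k j : ℕ) :
    (h : ℝ) * ⟪p, vertexPt h k (j + 1) - vertexPt h k j⟫ = p 1 := by
  have h0 : (0 : ℝ) < h := by exact_mod_cast hh
  simp only [E2_inner, vertexPt, PiLp.sub_apply, vtx_zero, vtx_one, Nat.cast_add, Nat.cast_one]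
  field_simp
  ring

lemma inner_grad_sub_eq {u : E2 → ℝ} {S : Set E2} (hS : Convex ℝ S) (hu : IsAffineOn u S)
    {x y z : E2} (hx : x ∈ S) (hy : y ∈ S) (hz : z ∈ S) (hd : DifferentiableAt ℝ u x) :
    ⟪grad u x, y - z⟫ = u y - u z := by
  have h1 := inner_grad_eq_sub hS hu hx hy hd
  have h2 := inner_grad_eq_sub hS hu hx hz hd
  rw [inner_sub_right] at *
  linarith

lemma grad_eq_of_mem_Kplus (hh : 1 ≤ h) {k j : ℕ} {u : E2 → ℝ}
    (hu : IsAffineOn u (Kplus h (k + 1) (j + 1))) {x : E2} (hx : x ∈ Kplus h (k + 1) (j + 1))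
    (hd : DifferentiableAt ℝ u x) :
    grad u x 0 = h * (u (vertexPt h (k + 1) j) - u (vertexPt h k j)) ∧
      grad u x 1 = h * (u (vertexPt h k (j + 1)) - u (vertexPt h k j)) := by
  obtain ⟨v1, v2, v3⟩ := vertices_mem_Kplus hh k j
  rw [← inner_grad_sub_eq (convex_Kplus hh k j) hu hx v2 v1 hd,
    ← inner_grad_sub_eq (convex_Kplus hh k j) hu hx v3 v1 hd,
    mul_inner_vertexPt_sub_horizontal hh, mul_inner_vertexPt_sub_vertical hh]
  exact ⟨rfl, rfl⟩

lemma grad_eq_of_mem_Kminus (hh : 1 ≤ h) {k j : ℕ} {u : E2 → ℝ}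
    (hu : IsAffineOn u (Kminus h (k + 1) (j + 1))) {x : E2} (hx : x ∈ Kminus h (k + 1) (j + 1))
    (hd : DifferentiableAt ℝ u x) :
    grad u x 0 = h * (u (vertexPt h (k + 1) (j + 1)) - u (vertexPt h k (j + 1))) ∧
      grad u x 1 = h * (u (vertexPt h (k + 1) (j + 1)) - u (vertexPt h (k + 1) j)) := by
  obtain ⟨v1, v2, v3⟩ := vertices_mem_Kminus hh k j
  rw [← inner_grad_sub_eq (convex_Kminus hh k j) hu hx v1 v3 hd,
    ← inner_grad_sub_eq (convex_Kminus hh k j) hu hx v1 v2 hd,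
    mul_inner_vertexPt_sub_horizontal hh, mul_inner_vertexPt_sub_vertical hh]
  exact ⟨rfl, rfl⟩

/-! ### Hat functions -/

/-- The hat function of the three-direction mesh of `ℝ²` with vertices `ℤ²`. -/
def refHat (s t : ℝ) : ℝ := max 0 (min (min (1 - |s|) (1 - |t|)) (1 - |s + t|))

lemma refHat_zero : refHat 0 0 = 1 := by simp [refHat]

lemma refHat_eq_zero_of_one_le_left {s t : ℝ} (hs : 1 ≤ |s|) : refHat s t = 0 :=
  max_eq_left (min_le_of_left_le (min_le_of_left_le (by linarith)))

lemma refHat_eq_zero_of_one_le_right {s t : ℝ} (ht : 1 ≤ |t|) : refHat s t = 0 :=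
  max_eq_left (min_le_of_left_le (min_le_of_right_le (by linarith)))

lemma refHat_eq_zero_of_one_le_add {s t : ℝ} (ht : 1 ≤ |s + t|) : refHat s t = 0 :=
  max_eq_left (min_le_of_right_le (by linarith))

lemma refHat_eq_of_le {s t : ℝ} (hst : 0 ≤ s * t) (h1 : |s + t| ≤ 1) :
    refHat s t = 1 - |s + t| := by
  have h := abs_add_eq_add_abs_iff s t |>.2 (mul_nonneg_iff.1 hst)
  have hs := abs_nonneg s
  have ht := abs_nonneg t
  rw [refHat, min_eq_right (le_min (by linarith) (by linarith)), max_eq_right (by linarith)]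

lemma refHat_eq_left_of_le {s t : ℝ} (hst : |t| ≤ |s|) (hst' : |s + t| ≤ |s|) (h1 : |s| ≤ 1) :
    refHat s t = 1 - |s| := by
  rw [refHat, min_eq_left (a := 1 - |s|) (by linarith), min_eq_left (by linarith),
    max_eq_right (by linarith)]

lemma refHat_eq_right_of_le {s t : ℝ} (hst : |s| ≤ |t|) (hst' : |s + t| ≤ |t|) (h1 : |t| ≤ 1) :
    refHat s t = 1 - |t| := by
  rw [refHat, min_eq_right (a := 1 - |s|) (by linarith), min_eq_left (by linarith),
    max_eq_right (by linarith)]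

lemma refHat_affine_lower (m n : ℤ) : ∃ α β γ : ℝ, ∀ s t : ℝ, m ≤ s → n ≤ t → s + t ≤ m + n + 1 →
    refHat s t = α * s + β * t + γ := by
  by_cases hm : 1 ≤ m ∨ m ≤ -2
  · refine ⟨0, 0, 0, fun s t hs ht hst => ?_⟩
    rw [refHat_eq_zero_of_one_le_left]
    · ring
    rcases hm with hm | hm <;> have hm' := (Int.cast_le (R := ℝ)).2 hm <;> push_cast at hm'
    · exact le_abs.2 (Or.inl (by linarith))
    · exact le_abs.2 (Or.inr (by linarith))
  by_cases hn : 1 ≤ n ∨ n ≤ -2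
  · refine ⟨0, 0, 0, fun s t hs ht hst => ?_⟩
    rw [refHat_eq_zero_of_one_le_right]
    · ring
    rcases hn with hn | hn <;> have hn' := (Int.cast_le (R := ℝ)).2 hn <;> push_cast at hn'
    · exact le_abs.2 (Or.inl (by linarith))
    · exact le_abs.2 (Or.inr (by linarith))
  obtain rfl | rfl : m = 0 ∨ m = -1 := by omega
  all_goals obtain rfl | rfl : n = 0 ∨ n = -1 := by omega
  · refine ⟨-1, -1, 1, fun s t hs ht hst => ?_⟩
    push_cast at hs ht hst
    have h1 : |s + t| = s + t := abs_of_nonneg (by linarith)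
    rw [refHat_eq_of_le (mul_nonneg hs ht) (by linarith), h1]
    ring
  · refine ⟨0, 1, 1, fun s t hs ht hst => ?_⟩
    push_cast at hs ht hst
    have h1 : |t| = -t := abs_of_nonpos (by linarith)
    rw [refHat_eq_right_of_le (by rw [h1]; exact abs_le.2 ⟨by linarith, by linarith⟩)
      (by rw [h1]; exact abs_le.2 ⟨by linarith, by linarith⟩) (by linarith), h1]
    ring
  · refine ⟨1, 0, 1, fun s t hs ht hst => ?_⟩
    push_cast at hs ht hst
    have h1 : |s| = -s := abs_of_nonpos (by linarith)
    rw [refHat_eq_left_of_le (by rw [h1]; exact abs_le.2 ⟨by linarith, by linarith⟩)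
      (by rw [h1]; exact abs_le.2 ⟨by linarith, by linarith⟩) (by linarith), h1]
    ring
  · refine ⟨0, 0, 0, fun s t hs ht hst => ?_⟩
    push_cast at hs ht hst
    rw [refHat_eq_zero_of_one_le_add (le_abs.2 (Or.inr (by linarith)))]
    ring

lemma refHat_neg (s t : ℝ) : refHat (-s) (-t) = refHat s t := by
  simp only [refHat, abs_neg, ← neg_add]

lemma refHat_affine_upper (m n : ℤ) : ∃ α β γ : ℝ, ∀ s t : ℝ, s ≤ m + 1 → t ≤ n + 1 →
    m + n + 1 ≤ s + t → refHat s t = α * s + β * t + γ := by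
  obtain ⟨α, β, γ, h⟩ := refHat_affine_lower (-(m + 1)) (-(n + 1))
  refine ⟨-α, -β, γ, fun s t hs ht hst => ?_⟩
  rw [← refHat_neg, h (-s) (-t) (by push_cast; linarith) (by push_cast; linarith)
    (by push_cast; linarith)]
  ring

lemma lipschitzWith_refHat_comp {f g : E2 → ℝ} {C C' : NNReal} (hf : LipschitzWith C f)
    (hg : LipschitzWith C' g) : ∃ K, LipschitzWith K fun x => refHat (f x) (g x) := by
  have habs : ∀ {K : NNReal} {f : E2 → ℝ}, LipschitzWith K f →
      LipschitzWith (0 + 1 * K) fun x => 1 - |f x| := fun hf =>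
    (LipschitzWith.const 1).sub (lipschitzWith_one_norm.comp hf)
  exact ⟨_, (LipschitzWith.const 0).max (((habs hf).min (habs hg)).min (habs (hf.add hg)))⟩

/-- Indices of the vertices of the mesh. -/
abbrev Node (h : ℕ) : Type := Fin (h + 1) × Fin (h + 1)

/-- The vertex with a given index. -/
noncomputable def nodePt (i : Node h) : E2 := vertexPt h i.1 i.2

/-- The nodal basis function of the vertex `i`. -/
noncomputable def hat (i : Node h) (x : E2) : ℝ := refHat (h * x 0 - i.1) (h * x 1 - i.2)

/-- The finite element function with given nodal values. -/
noncomputable def nodalFn (a : Node h → ℝ) (x : E2) : ℝ := ∑ i, a i * hat i x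

/-- The nodal values of a function. -/
noncomputable def nodalVal (h : ℕ) (u : E2 → ℝ) (i : Node h) : ℝ := u (nodePt i)

lemma nodePt_mem_Delta (i : Node h) : nodePt i ∈ Delta h :=
  ⟨i.1, i.2, i.1.is_le, i.2.is_le, rfl⟩

lemma nodePt_mem_OmegaCl (hh : 1 ≤ h) (i : Node h) : nodePt i ∈ OmegaCl := by
  have h0 : (0 : ℝ) < h := by exact_mod_cast hh
  have : ∀ k : Fin (h + 1), ((k : ℕ) : ℝ) / h ∈ Icc (0 : ℝ) 1 := fun k =>
    ⟨by positivity, div_le_one_of_le₀ (by exact_mod_cast k.is_le) h0.le⟩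
  exact ⟨this i.1, this i.2⟩

lemma exists_nodePt_eq {k j : ℕ} (hk : k ≤ h) (hj : j ≤ h) :
    ∃ i : Node h, nodePt i = vertexPt h k j :=
  ⟨(⟨k, by omega⟩, ⟨j, by omega⟩), rfl⟩

lemma hat_nonneg (i : Node h) (x : E2) : 0 ≤ hat i x := le_max_left _ _

lemma hat_le_one (i : Node h) (x : E2) : hat i x ≤ 1 := by
  refine max_le zero_le_one (min_le_of_left_le (min_le_of_left_le ?_))
  have := abs_nonneg ((h : ℝ) * x 0 - (i.1 : ℕ))
  linarith

lemma exists_lipschitzWith_hat (i : Node h) : ∃ K, LipschitzWith K (hat i) := by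
  have hcoord : ∀ (l : Fin 2) (c : ℝ), ∃ K, LipschitzWith K fun x : E2 => h * x l - c := by
    intro l c
    let p : E2 →L[ℝ] ℝ := (h : ℝ) • EuclideanSpace.proj l
    exact ⟨_, p.lipschitz.sub (LipschitzWith.const c)⟩
  obtain ⟨C, hC⟩ := hcoord 0 (i.1 : ℕ)
  obtain ⟨C', hC'⟩ := hcoord 1 (i.2 : ℕ)
  exact lipschitzWith_refHat_comp hC hC'

lemma one_le_abs_natCast_sub {m n : ℕ} (hmn : m ≠ n) : (1 : ℝ) ≤ |(m : ℝ) - n| := by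
  have : (1 : ℤ) ≤ |(m : ℤ) - n| := Int.one_le_abs (by omega)
  exact_mod_cast this

lemma hat_nodePt (hh : 1 ≤ h) (i j : Node h) : hat i (nodePt j) = if i = j then 1 else 0 := by
  rw [hat, nodePt, mul_vertexPt_zero hh, mul_vertexPt_one hh]
  split_ifs with hij
  · simp [hij, refHat_zero]
  · by_cases h1 : (j.1 : ℕ) = i.1
    · have h2 : (j.2 : ℕ) ≠ i.2 := fun h2 => hij (Prod.ext (Fin.ext h1.symm) (Fin.ext h2.symm))
      exact refHat_eq_zero_of_one_le_right (one_le_abs_natCast_sub h2)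
    · exact refHat_eq_zero_of_one_le_left (one_le_abs_natCast_sub h1)

lemma nodalFn_nodePt (hh : 1 ≤ h) (a : Node h → ℝ) (j : Node h) : nodalFn a (nodePt j) = a j := by
  simp [nodalFn, hat_nodePt hh]

lemma nodalVal_nodalFn (hh : 1 ≤ h) (a : Node h → ℝ) : nodalVal h (nodalFn a) = a :=
  funext (nodalFn_nodePt hh a)

lemma continuous_hat (i : Node h) : Continuous (hat i) :=
  let ⟨_, hK⟩ := exists_lipschitzWith_hat i
  hK.continuous

lemma continuous_nodalFn (a : Node h → ℝ) : Continuous (nodalFn a) :=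
  continuous_finsetSum _ fun i _ => continuous_const.mul (continuous_hat i)

lemma isAffineOn_hat_Kplus (hh : 1 ≤ h) (i : Node h) (k j : ℕ) :
    IsAffineOn (hat i) (Kplus h (k + 1) (j + 1)) := by
  obtain ⟨α, β, γ, hα⟩ := refHat_affine_lower ((k : ℤ) - (i.1 : ℕ)) ((j : ℤ) - (i.2 : ℕ))
  refine ⟨vtx (α * h) (β * h), γ - α * (i.1 : ℕ) - β * (i.2 : ℕ), fun x hx => ?_⟩
  obtain ⟨h1, h2, h3⟩ := (mem_Kplus_iff hh k j x).1 hx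
  rw [hat, hα _ _ (by push_cast; linarith) (by push_cast; linarith) (by push_cast; linarith),
    E2_inner, vtx_zero, vtx_one]
  ring

lemma isAffineOn_hat_Kminus (hh : 1 ≤ h) (i : Node h) (k j : ℕ) :
    IsAffineOn (hat i) (Kminus h (k + 1) (j + 1)) := by
  obtain ⟨α, β, γ, hα⟩ := refHat_affine_upper ((k : ℤ) - (i.1 : ℕ)) ((j : ℤ) - (i.2 : ℕ))
  refine ⟨vtx (α * h) (β * h), γ - α * (i.1 : ℕ) - β * (i.2 : ℕ), fun x hx => ?_⟩
  obtain ⟨h1, h2, h3⟩ := (mem_Kminus_iff hh k j x).1 hx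
  rw [hat, hα _ _ (by push_cast; linarith) (by push_cast; linarith) (by push_cast; linarith),
    E2_inner, vtx_zero, vtx_one]
  ring

lemma IsAffineOn.sum_mul {ι : Type*} [Fintype ι] {f : ι → E2 → ℝ} {S : Set E2}
    (hf : ∀ i, IsAffineOn (f i) S) (a : ι → ℝ) : IsAffineOn (fun x => ∑ i, a i * f i x) S := by
  choose b c hbc using hf
  refine ⟨∑ i, a i • b i, ∑ i, a i * c i, fun x hx => ?_⟩
  rw [sum_inner, ← Finset.sum_add_distrib]
  refine Finset.sum_congr rfl fun i _ => ?_
  rw [hbc i x hx, real_inner_smul_left]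
  ring

lemma isAffineOn_nodalFn_Kplus (hh : 1 ≤ h) (a : Node h → ℝ) (k j : ℕ) :
    IsAffineOn (nodalFn a) (Kplus h (k + 1) (j + 1)) :=
  IsAffineOn.sum_mul (fun i => isAffineOn_hat_Kplus hh i k j) a

lemma isAffineOn_nodalFn_Kminus (hh : 1 ≤ h) (a : Node h → ℝ) (k j : ℕ) :
    IsAffineOn (nodalFn a) (Kminus h (k + 1) (j + 1)) :=
  IsAffineOn.sum_mul (fun i => isAffineOn_hat_Kminus hh i k j) a

lemma memF_nodalFn (hh : 1 ≤ h) (a : Node h → ℝ) : MemF h (nodalFn a) := by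
  refine ⟨(continuous_nodalFn a).continuousOn, fun k j hk _ hj _ => ?_⟩
  obtain ⟨k, rfl⟩ := Nat.exists_eq_add_of_le' hk
  obtain ⟨j, rfl⟩ := Nat.exists_eq_add_of_le' hj
  exact ⟨isAffineOn_nodalFn_Kplus hh a k j, isAffineOn_nodalFn_Kminus hh a k j⟩

lemma MemF.eqOn_OmegaCl (hh : 1 ≤ h) {u v : E2 → ℝ} (hu : MemF h u) (hv : MemF h v)
    (huv : ∀ i : Node h, u (nodePt i) = v (nodePt i)) : EqOn u v OmegaCl := by
  have hvert : ∀ {k j : ℕ}, k ≤ h → j ≤ h → u (vertexPt h k j) = v (vertexPt h k j) := by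
    intro k j hk hj
    obtain ⟨i, hi⟩ := exists_nodePt_eq hk hj
    rw [← hi]
    exact huv i
  intro x hx
  obtain ⟨k, hk, j, hj, hx | hx⟩ := exists_triangle hh hx
  · rw [(hu.2 (k + 1) (j + 1) (by omega) hk (by omega) hj).1.eqOn_Kplus hh hx,
      (hv.2 (k + 1) (j + 1) (by omega) hk (by omega) hj).1.eqOn_Kplus hh hx,
      hvert hk.le hj.le, hvert hk hj.le, hvert hk.le hj]
  · rw [(hu.2 (k + 1) (j + 1) (by omega) hk (by omega) hj).2.eqOn_Kminus hh hx,
      (hv.2 (k + 1) (j + 1) (by omega) hk (by omega) hj).2.eqOn_Kminus hh hx,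
      hvert hk hj, hvert hk hj.le, hvert hk.le hj]

lemma MemF.eqOn_nodalFn (hh : 1 ≤ h) {u : E2 → ℝ} (hu : MemF h u) :
    EqOn u (nodalFn (nodalVal h u)) OmegaCl :=
  hu.eqOn_OmegaCl hh (memF_nodalFn hh _) fun i => (nodalFn_nodePt hh (nodalVal h u) i).symm

lemma Omega_subset_OmegaCl : Omega ⊆ OmegaCl := fun _ hx =>
  ⟨Ioo_subset_Icc_self hx.1, Ioo_subset_Icc_self hx.2⟩

lemma isOpen_Omega : IsOpen Omega := by
  have h0 : Continuous fun x : E2 => x 0 := by fun_prop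
  have h1 : Continuous fun x : E2 => x 1 := by fun_prop
  exact (isOpen_Ioo.preimage h0).inter (isOpen_Ioo.preimage h1)

lemma MemF.grad_eq (hh : 1 ≤ h) {u : E2 → ℝ} (hu : MemF h u) {x : E2} (hx : x ∈ Omega) :
    grad u x = grad (nodalFn (nodalVal h u)) x := by
  have heq : u =ᶠ[𝓝 x] nodalFn (nodalVal h u) :=
    Filter.eventuallyEq_of_mem (isOpen_Omega.mem_nhds hx)
      fun y hy => hu.eqOn_nodalFn hh (Omega_subset_OmegaCl hy)
  simp only [grad, gradient, heq.fderiv_eq]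

lemma Ph_eq (hh : 1 ≤ h) (f : E2 → ℝ) : EqOn (Ph h f) (nodalFn (nodalVal h f)) OmegaCl := by
  have hex : ∃ p, Interpolates h f p := by
    refine ⟨nodalFn (nodalVal h f), memF_nodalFn hh _, ?_⟩
    rintro x ⟨k, j, hk, hj, rfl⟩
    exact nodalFn_nodePt hh (nodalVal h f) (⟨k, by omega⟩, ⟨j, by omega⟩)
  rw [Ph, dif_pos hex]
  refine hex.choose_spec.1.eqOn_OmegaCl hh (memF_nodalFn hh _) fun i => ?_
  rw [hex.choose_spec.2 _ (nodePt_mem_Delta i), nodalFn_nodePt hh]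
  rfl

lemma nodalFn_mono {a b : Node h → ℝ} (hab : a ≤ b) (x : E2) : nodalFn a x ≤ nodalFn b x :=
  Finset.sum_le_sum fun i _ => mul_le_mul_of_nonneg_right (hab i) (hat_nonneg i x)

lemma nodalFn_nonneg {a : Node h → ℝ} (ha : 0 ≤ a) (x : E2) : 0 ≤ nodalFn a x :=
  Finset.sum_nonneg fun i _ => mul_nonneg (ha i) (hat_nonneg i x)

lemma memF_one : MemF h fun _ => 1 :=
  ⟨continuousOn_const, fun _ _ _ _ _ _ => ⟨⟨0, 1, by simp⟩, ⟨0, 1, by simp⟩⟩⟩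

lemma nodalFn_one (hh : 1 ≤ h) {x : E2} (hx : x ∈ OmegaCl) :
    nodalFn (1 : Node h → ℝ) x = 1 :=
  ((memF_one (h := h)).eqOn_nodalFn hh hx).symm

lemma hat_eq_zero_of_mem_OmegaBd (hh : 1 ≤ h) {i : Node h} (hi : nodePt i ∉ OmegaBd) {x : E2}
    (hx : x ∈ OmegaBd) : hat i x = 0 := by
  have h0 : (0 : ℝ) < h := by exact_mod_cast hh
  have hiO : nodePt i ∈ Omega := by
    by_contra hc
    exact hi ⟨nodePt_mem_OmegaCl hh i, hc⟩
  have hscale : ∀ (r : ℝ) (n : ℕ), h * r = n → r ∈ Ioo (0 : ℝ) 1 → 1 ≤ n ∧ n + 1 ≤ h := by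
    intro r n hrn hr
    have h1 : (0 : ℝ) < n := by rw [← hrn]; exact mul_pos h0 hr.1
    have h2 : (n : ℝ) < h := by rw [← hrn]; nlinarith [hr.2]
    exact ⟨by exact_mod_cast h1, by exact_mod_cast h2⟩
  have hfar : ∀ (r : ℝ) (n : ℕ), 1 ≤ n ∧ n + 1 ≤ h → r ∈ Icc (0 : ℝ) 1 → r ∉ Ioo (0 : ℝ) 1 →
      1 ≤ |h * r - n| := by
    intro r n hn hr hr'
    have h1 : (1 : ℝ) ≤ n := by exact_mod_cast hn.1
    have h2 : (n : ℝ) + 1 ≤ h := by exact_mod_cast hn.2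
    rcases hr.1.eq_or_lt with rfl | hr0
    · exact le_abs.2 (Or.inr (by linarith))
    rcases hr.2.eq_or_lt with rfl | hr1
    · exact le_abs.2 (Or.inl (by linarith))
    exact absurd ⟨hr0, hr1⟩ hr'
  by_cases hx0 : x 0 ∈ Ioo (0 : ℝ) 1
  · have hx1 : x 1 ∉ Ioo (0 : ℝ) 1 := fun hx1 => hx.2 ⟨hx0, hx1⟩
    exact refHat_eq_zero_of_one_le_right
      (hfar _ _ (hscale _ _ (mul_vertexPt_one hh i.1 i.2) hiO.2) hx.1.2 hx1)
  · exact refHat_eq_zero_of_one_le_left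
      (hfar _ _ (hscale _ _ (mul_vertexPt_zero hh i.1 i.2) hiO.1) hx.1.1 hx0)

lemma memA_iff (hh : 1 ≤ h) {w u : E2 → ℝ} (hw : MemF h w) (hu : MemF h u) :
    MemA h w u ↔ ∀ i ∈ {i : Node h | nodePt i ∈ OmegaBd}, nodalVal h u i = nodalVal h w i := by
  refine ⟨fun hA i hi => hA.2 _ hi, fun hbd => ⟨hu, fun x hx => ?_⟩⟩
  rw [hu.eqOn_nodalFn hh hx.1, hw.eqOn_nodalFn hh hx.1]
  refine Finset.sum_congr rfl fun i _ => ?_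
  by_cases hi : nodePt i ∈ OmegaBd
  · rw [hbd i hi]
  · rw [hat_eq_zero_of_mem_OmegaBd hh hi hx, mul_zero, mul_zero]

lemma nodalFn_sub (a b : Node h → ℝ) (x : E2) :
    nodalFn (a - b) x = nodalFn a x - nodalFn b x := by
  simp only [nodalFn, Pi.sub_apply, sub_mul, Finset.sum_sub_distrib]

lemma nonneg_of_nodalFn_nonneg (hh : 1 ≤ h) {a : Node h → ℝ}
    (ha : ∀ x ∈ Omega, 0 ≤ nodalFn a x) : 0 ≤ a := by
  intro i
  let p : ℝ → E2 := fun s => nodePt i + s • (vtx (1 / 2) (1 / 2) - nodePt i)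
  have hp : ∀ s ∈ Ioo (0 : ℝ) 1, p s ∈ Omega := by
    intro s hs
    obtain ⟨⟨h1, h2⟩, h3, h4⟩ := nodePt_mem_OmegaCl hh i
    refine ⟨⟨?_, ?_⟩, ⟨?_, ?_⟩⟩ <;>
      simp only [p, PiLp.add_apply, PiLp.smul_apply, PiLp.sub_apply, smul_eq_mul, vtx_zero,
        vtx_one] <;> nlinarith [hs.1, hs.2]
  have hcont : Continuous fun s => nodalFn a (p s) :=
    (continuous_nodalFn a).comp (by fun_prop)
  have hlim : Tendsto (fun s => nodalFn a (p s)) (𝓝[>] 0) (𝓝 (a i)) := by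
    have := (hcont.tendsto 0).mono_left (nhdsWithin_le_nhds (s := Ioi (0 : ℝ)))
    simpa [p, nodalFn_nodePt hh] using this
  refine ge_of_tendsto hlim ?_
  filter_upwards [Ioo_mem_nhdsGT (zero_lt_one (α := ℝ))] with s hs
  exact ha _ (hp s hs)

lemma nodalVal_le_of_le (hh : 1 ≤ h) {u v : E2 → ℝ} (hu : MemF h u) (hv : MemF h v)
    (huv : ∀ x ∈ Omega, u x ≤ v x) : nodalVal h u ≤ nodalVal h v := by
  refine sub_nonneg.1 (nonneg_of_nodalFn_nonneg hh fun x hx => ?_)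
  have hx' := Omega_subset_OmegaCl hx
  rw [nodalFn_sub, ← hu.eqOn_nodalFn hh hx', ← hv.eqOn_nodalFn hh hx']
  exact sub_nonneg.2 (huv x hx)

end FiniteElements

section Energy

open Set Topology Matrix

variable {h : ℕ}

/-! ### Gradients of finite element functions -/

lemma ae_differentiableAt_hat (h : ℕ) :
    ∀ᵐ x : E2, ∀ i : Node h, DifferentiableAt ℝ (hat i) x :=
  ae_all_iff.2 fun i =>
    let ⟨_, hK⟩ := exists_lipschitzWith_hat i
    hK.ae_differentiableAt

lemma norm_grad_hat_le (i : Node h) : ∃ C : ℝ, ∀ x, ‖grad (hat i) x‖ ≤ C := by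
  obtain ⟨K, hK⟩ := exists_lipschitzWith_hat i
  refine ⟨K, fun x => ?_⟩
  rw [grad, gradient, LinearIsometryEquiv.norm_map]
  exact norm_fderiv_le_of_lipschitz ℝ hK

lemma measurable_grad (u : E2 → ℝ) : Measurable (grad u) :=
  (InnerProductSpace.toDual ℝ E2).symm.continuous.measurable.comp (measurable_fderiv ℝ u)

lemma differentiableAt_nodalFn {x : E2} (hx : ∀ i : Node h, DifferentiableAt ℝ (hat i) x)
    (a : Node h → ℝ) : DifferentiableAt ℝ (nodalFn a) x :=
  DifferentiableAt.fun_sum fun i _ => (hx i).const_mul (a i)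

lemma grad_nodalFn {x : E2} (hx : ∀ i : Node h, DifferentiableAt ℝ (hat i) x)
    (a : Node h → ℝ) : grad (nodalFn a) x = ∑ i, a i • grad (hat i) x := by
  have hfd : fderiv ℝ (nodalFn a) x = ∑ i, a i • fderiv ℝ (hat i) x := by
    have := HasFDerivAt.fun_sum (u := Finset.univ) (A := fun i y => a i * hat i y)
      fun i _ => (hx i).hasFDerivAt.const_mul (a i)
    exact this.fderiv
  rw [grad, gradient, hfd, map_sum]
  simp only [grad, gradient, map_smulₛₗ, conj_trivial]

lemma exists_grad_nodalFn_eq (hh : 1 ≤ h) {x : E2} (hxcl : x ∈ OmegaCl)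
    (hx : ∀ i : Node h, DifferentiableAt ℝ (hat i) x) :
    ∃ i j k l : Node h, ∀ a, grad (nodalFn a) x 0 = h * (a i - a j) ∧
      grad (nodalFn a) x 1 = h * (a k - a l) := by
  have hval : ∀ {k j : ℕ} (hk : k ≤ h) (hj : j ≤ h) (a : Node h → ℝ),
      nodalFn a (vertexPt h k j) = a (⟨k, by omega⟩, ⟨j, by omega⟩) := fun hk hj a =>
    nodalFn_nodePt hh a (⟨_, by omega⟩, ⟨_, by omega⟩)
  obtain ⟨k, hk, j, hj, hxK | hxK⟩ := exists_triangle hh hxcl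
  · refine ⟨(⟨k + 1, by omega⟩, ⟨j, by omega⟩), (⟨k, by omega⟩, ⟨j, by omega⟩),
      (⟨k, by omega⟩, ⟨j + 1, by omega⟩), (⟨k, by omega⟩, ⟨j, by omega⟩), fun a => ?_⟩
    have := grad_eq_of_mem_Kplus hh (isAffineOn_nodalFn_Kplus hh a k j) hxK
      (differentiableAt_nodalFn hx a)
    rwa [hval hk hj.le, hval hk.le hj.le, hval hk.le hj] at this
  · refine ⟨(⟨k + 1, by omega⟩, ⟨j + 1, by omega⟩), (⟨k, by omega⟩, ⟨j + 1, by omega⟩),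
      (⟨k + 1, by omega⟩, ⟨j + 1, by omega⟩), (⟨k + 1, by omega⟩, ⟨j, by omega⟩), fun a => ?_⟩
    have := grad_eq_of_mem_Kminus hh (isAffineOn_nodalFn_Kminus hh a k j) hxK
      (differentiableAt_nodalFn hx a)
    rwa [hval hk hj, hval hk.le hj, hval hk hj.le] at this

lemma norm_grad_nodalFn_sup_zero_le (hh : 1 ≤ h) {x : E2} (hxcl : x ∈ OmegaCl)
    (hx : ∀ i : Node h, DifferentiableAt ℝ (hat i) x) (a : Node h → ℝ) :
    ‖grad (nodalFn (a ⊔ 0)) x‖ ^ 2 ≤ ‖grad (nodalFn a) x‖ ^ 2 := by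
  obtain ⟨i, j, k, l, hgrad⟩ := exists_grad_nodalFn_eq hh hxcl hx
  have hsup : ∀ r s : ℝ, (h * (r ⊔ 0 - s ⊔ 0)) ^ 2 ≤ (h * (r - s)) ^ 2 := fun r s => by
    rw [mul_pow, mul_pow]
    exact mul_le_mul_of_nonneg_left (sq_le_sq.2 (abs_max_sub_max_le_abs r s 0)) (sq_nonneg _)
  simp only [E2_norm_sq, hgrad, Pi.sup_apply, Pi.zero_apply]
  exact add_le_add (hsup _ _) (hsup _ _)

/-! ### Integrability -/

lemma measurableSet_Omega : MeasurableSet Omega := isOpen_Omega.measurableSet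

instance isFiniteMeasure_restrict_Omega : IsFiniteMeasure (volume.restrict Omega) := by
  refine ⟨?_⟩
  rw [Measure.restrict_apply_univ]
  refine (measure_mono fun x hx => ?_).trans_lt
    (measure_closedBall_lt_top (x := (0 : E2)) (r := 2))
  obtain ⟨⟨h1, h2⟩, h3, h4⟩ := hx
  rw [mem_closedBall_zero_iff]
  have := E2_norm_sq x
  nlinarith [norm_nonneg x]

lemma ae_restrict_Omega (h : ℕ) {p : E2 → Prop}
    (hp : ∀ x ∈ Omega, (∀ i : Node h, DifferentiableAt ℝ (hat i) x) → p x) :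
    ∀ᵐ x ∂volume.restrict Omega, p x := by
  rw [ae_restrict_iff' measurableSet_Omega]
  filter_upwards [ae_differentiableAt_hat h] with x hx hxO using hp x hxO hx

lemma integrable_inner_grad_hat (i j : Node h) :
    Integrable (fun x => ⟪grad (hat i) x, grad (hat j) x⟫) (volume.restrict Omega) := by
  obtain ⟨C, hC⟩ := norm_grad_hat_le i
  obtain ⟨C', hC'⟩ := norm_grad_hat_le j
  refine Integrable.of_bound ((measurable_grad _).inner (measurable_grad _)).aestronglyMeasurable
    (C * C') (ae_of_all _ fun x => ?_)
  exact (norm_inner_le_norm _ _).trans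
    (mul_le_mul (hC x) (hC' x) (norm_nonneg _) ((norm_nonneg _).trans (hC x)))

lemma integrable_hat_mul_inner (k i j : Node h) :
    Integrable (fun x => hat k x * ⟪grad (hat i) x, grad (hat j) x⟫) (volume.restrict Omega) := by
  refine (integrable_inner_grad_hat i j).bdd_mul
    (continuous_hat k).aestronglyMeasurable (c := 1) (ae_of_all _ fun x => ?_)
  rw [Real.norm_of_nonneg (hat_nonneg k x)]
  exact hat_le_one k x

lemma integrable_hat (k : Node h) : Integrable (hat k) (volume.restrict Omega) := by
  refine Integrable.of_bound (continuous_hat k).aestronglyMeasurable 1 (ae_of_all _ fun x => ?_)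
  rw [Real.norm_of_nonneg (hat_nonneg k x)]
  exact hat_le_one k x

lemma integrable_nodalFn (c : Node h → ℝ) : Integrable (nodalFn c) (volume.restrict Omega) :=
  integrable_finsetSum _ fun k _ => (integrable_hat k).const_mul (c k)

lemma integrable_nodalFn_mul_inner_hat (c : Node h → ℝ) (i j : Node h) :
    Integrable (fun x => nodalFn c x * ⟪grad (hat i) x, grad (hat j) x⟫)
      (volume.restrict Omega) := by
  simp only [nodalFn, Finset.sum_mul, mul_assoc]
  exact integrable_finsetSum _ fun k _ => (integrable_hat_mul_inner k i j).const_mul (c k)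

lemma inner_grad_nodalFn {x : E2} (hx : ∀ i : Node h, DifferentiableAt ℝ (hat i) x)
    (a a' : Node h → ℝ) : ⟪grad (nodalFn a) x, grad (nodalFn a') x⟫ =
      ∑ i, ∑ j, a i * a' j * ⟪grad (hat i) x, grad (hat j) x⟫ := by
  rw [grad_nodalFn hx, grad_nodalFn hx, sum_inner]
  refine Finset.sum_congr rfl fun i _ => ?_
  rw [inner_sum]
  refine Finset.sum_congr rfl fun j _ => ?_
  rw [real_inner_smul_left, real_inner_smul_right]
  ring

lemma nodalFn_mul_inner_ae_eq (c a a' : Node h → ℝ) :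
    (fun x => nodalFn c x * ⟪grad (nodalFn a) x, grad (nodalFn a') x⟫)
      =ᵐ[volume.restrict Omega] fun x => ∑ i, ∑ j, a i * a' j *
        (nodalFn c x * ⟪grad (hat i) x, grad (hat j) x⟫) :=
  ae_restrict_Omega h fun x _ hx => by
    simp only [inner_grad_nodalFn hx, Finset.mul_sum]
    exact Finset.sum_congr rfl fun i _ => Finset.sum_congr rfl fun j _ => by ring

lemma integrable_nodalFn_mul_inner (c a d : Node h → ℝ) :
    Integrable (fun x => nodalFn c x * ⟪grad (nodalFn a) x, grad (nodalFn d) x⟫)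
      (volume.restrict Omega) :=
  Integrable.congr (integrable_finsetSum _ fun i _ => integrable_finsetSum _ fun j _ =>
    (integrable_nodalFn_mul_inner_hat c i j).const_mul _) (nodalFn_mul_inner_ae_eq c a d).symm

/-! ### The stiffness matrix -/

/-- The stiffness matrix with the coefficient whose nodal values are `c`. -/
noncomputable def stiffness (c : Node h → ℝ) : Matrix (Node h) (Node h) ℝ :=
  Matrix.of fun i j => ∫ x in Omega, nodalFn c x * ⟪grad (hat i) x, grad (hat j) x⟫

lemma dotProduct_stiffness (c a a' : Node h → ℝ) : a ⬝ᵥ stiffness c *ᵥ a' =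
    ∫ x in Omega, nodalFn c x * ⟪grad (nodalFn a) x, grad (nodalFn a') x⟫ := by
  rw [integral_congr_ae (nodalFn_mul_inner_ae_eq c a a'), integral_finsetSum _ fun i _ =>
    integrable_finsetSum _ fun j _ => (integrable_nodalFn_mul_inner_hat c i j).const_mul _]
  simp only [dotProduct, mulVec, stiffness, Matrix.of_apply, Finset.mul_sum]
  refine Finset.sum_congr rfl fun i _ => ?_
  rw [integral_finsetSum _ fun j _ => (integrable_nodalFn_mul_inner_hat c i j).const_mul _]
  refine Finset.sum_congr rfl fun j _ => ?_
  rw [integral_const_mul]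
  ring

lemma continuous_stiffness : Continuous (stiffness : (Node h → ℝ) → _) := by
  have heq : ∀ c : Node h → ℝ, stiffness c = Matrix.of fun i j =>
      ∑ k, c k * ∫ x in Omega, hat k x * ⟪grad (hat i) x, grad (hat j) x⟫ := by
    intro c
    ext i j
    simp only [stiffness, Matrix.of_apply, nodalFn, Finset.sum_mul, mul_assoc]
    rw [integral_finsetSum _ fun k _ => (integrable_hat_mul_inner k i j).const_mul (c k)]
    simp only [integral_const_mul]
  rw [funext heq]
  refine continuous_matrix fun i j => ?_
  simp only [Matrix.of_apply]
  fun_prop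

lemma isSymm_stiffness (c : Node h → ℝ) : (stiffness c).IsSymm := by
  refine Matrix.IsSymm.ext fun i j => ?_
  simp only [stiffness, Matrix.of_apply, real_inner_comm]

lemma stiffness_nonneg {c : Node h → ℝ} (hc : 0 ≤ c) (a : Node h → ℝ) :
    0 ≤ a ⬝ᵥ stiffness c *ᵥ a := by
  rw [dotProduct_stiffness]
  exact integral_nonneg fun x => mul_nonneg (nodalFn_nonneg hc x) real_inner_self_nonneg

lemma stiffness_mono {c c' : Node h → ℝ} (hc : c ≤ c') (a : Node h → ℝ) :
    a ⬝ᵥ stiffness c *ᵥ a ≤ a ⬝ᵥ stiffness c' *ᵥ a := by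
  rw [dotProduct_stiffness, dotProduct_stiffness]
  exact integral_mono (integrable_nodalFn_mul_inner c a a) (integrable_nodalFn_mul_inner c' a a)
    fun x => mul_le_mul_of_nonneg_right (nodalFn_mono hc x) real_inner_self_nonneg

lemma stiffness_sup_zero_le (hh : 1 ≤ h) {c : Node h → ℝ} (hc : 0 ≤ c) (a : Node h → ℝ) :
    (a ⊔ 0) ⬝ᵥ stiffness c *ᵥ (a ⊔ 0) ≤ a ⬝ᵥ stiffness c *ᵥ a := by
  rw [dotProduct_stiffness, dotProduct_stiffness]
  refine integral_mono_ae (integrable_nodalFn_mul_inner c _ _) (integrable_nodalFn_mul_inner c a a)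
    (ae_restrict_Omega h fun x hxO hx => ?_)
  simp only [real_inner_self_eq_norm_sq]
  exact mul_le_mul_of_nonneg_left
    (norm_grad_nodalFn_sup_zero_le hh (Omega_subset_OmegaCl hxO) hx a) (nodalFn_nonneg hc x)

lemma nodalFn_pos (hh : 1 ≤ h) {c : Node h → ℝ} (hc : ∀ i, 0 < c i) {x : E2}
    (hx : x ∈ OmegaCl) : 0 < nodalFn c x := by
  have hnn : ∀ i, 0 ≤ c i * hat i x := fun i => mul_nonneg (hc i).le (hat_nonneg i x)
  refine (Finset.sum_nonneg fun i _ => hnn i).lt_of_ne' fun h0 => ?_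
  have h1 := nodalFn_one hh hx
  have h2 := (Finset.sum_eq_zero_iff_of_nonneg fun i _ => hnn i).1 h0
  rw [nodalFn, Finset.sum_eq_zero] at h1
  · exact zero_ne_one h1
  · intro i hi
    rw [(mul_eq_zero.1 (h2 i hi)).resolve_left (hc i).ne', mul_zero]

lemma exists_mem_Kplus_of_ae (hh : 1 ≤ h) {p : E2 → Prop}
    (hp : ∀ᵐ x ∂volume.restrict Omega, p x) {k j : ℕ} (hk : k < h) (hj : j < h) :
    ∃ x ∈ Kplus h (k + 1) (j + 1), p x := by
  have h0 : (0 : ℝ) < h := by exact_mod_cast hh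
  rw [ae_restrict_iff' measurableSet_Omega] at hp
  let U : Set E2 :=
    {x | (k : ℝ) < h * x 0} ∩ {x | (j : ℝ) < h * x 1} ∩ {x | h * x 0 + h * x 1 < k + j + 1}
  have hU : IsOpen U :=
    ((isOpen_lt (by fun_prop) (by fun_prop)).inter (isOpen_lt (by fun_prop) (by fun_prop))).inter
      (isOpen_lt (by fun_prop) (by fun_prop))
  have hne : U.Nonempty := by
    refine ⟨vtx ((k + 1 / 3) / h) ((j + 1 / 3) / h), ⟨?_, ?_⟩, ?_⟩ <;>
      simp only [mem_ofPred_eq, vtx_zero, vtx_one, mul_div_cancel₀ _ h0.ne'] <;> linarith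
  obtain ⟨x, hpx, ⟨hx0, hx1⟩, hx2⟩ :=
    (Measure.dense_of_ae hp).exists_mem_open hU hne
  simp only [mem_ofPred_eq] at hx0 hx1 hx2
  have hk' : (k : ℝ) + 1 ≤ h := by exact_mod_cast hk
  have hj' : (j : ℝ) + 1 ≤ h := by exact_mod_cast hj
  have hk0 : (0 : ℝ) ≤ k := k.cast_nonneg
  have hj0 : (0 : ℝ) ≤ j := j.cast_nonneg
  refine ⟨x, (mem_Kplus_iff hh k j x).2 ⟨hx0.le, hx1.le, hx2.le⟩, hpx ⟨⟨?_, ?_⟩, ?_, ?_⟩⟩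
  · exact pos_of_mul_pos_right (hk0.trans_lt hx0) h0.le
  · exact lt_of_mul_lt_mul_left (by linarith) h0.le
  · exact pos_of_mul_pos_right (hj0.trans_lt hx1) h0.le
  · exact lt_of_mul_lt_mul_left (by linarith) h0.le

lemma eq_zero_of_stiffness_eq_zero (hh : 1 ≤ h) {c : Node h → ℝ} (hc : ∀ i, 0 < c i)
    {z : Node h → ℝ} (hbd : ∀ i : Node h, nodePt i ∈ OmegaBd → z i = 0)
    (hz : z ⬝ᵥ stiffness c *ᵥ z = 0) : z = 0 := by
  have h0 : (0 : ℝ) < h := by exact_mod_cast hh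
  have hzv : ∀ i : Node h, nodalFn z (vertexPt h i.1 i.2) = z i := nodalFn_nodePt hh z
  rw [dotProduct_stiffness, integral_eq_zero_iff_of_nonneg
    (fun x => mul_nonneg (nodalFn_nonneg (fun i => (hc i).le) x) real_inner_self_nonneg)
    (integrable_nodalFn_mul_inner c z z)] at hz
  have hae : ∀ᵐ x ∂volume.restrict Omega,
      grad (nodalFn z) x = 0 ∧ ∀ i : Node h, DifferentiableAt ℝ (hat i) x := by
    filter_upwards [hz, ae_restrict_mem measurableSet_Omega,
      ae_restrict_Omega h fun x _ hx => hx] with x hx hxO hxd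
    exact ⟨inner_self_eq_zero.1 ((mul_eq_zero.1 hx).resolve_left
      (nodalFn_pos hh hc (Omega_subset_OmegaCl hxO)).ne'), hxd⟩
  have hstep : ∀ k j : ℕ, k < h → j < h →
      nodalFn z (vertexPt h (k + 1) j) = nodalFn z (vertexPt h k j) := by
    intro k j hk hj
    obtain ⟨x, hxK, hx, hxd⟩ := exists_mem_Kplus_of_ae hh hae hk hj
    have := (grad_eq_of_mem_Kplus hh (isAffineOn_nodalFn_Kplus hh z k j) hxK
      (differentiableAt_nodalFn hxd z)).1
    rw [hx, PiLp.zero_apply, eq_comm] at this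
    exact sub_eq_zero.1 ((mul_eq_zero.1 this).resolve_left h0.ne')
  have hzero : ∀ j < h, ∀ k ≤ h, nodalFn z (vertexPt h k j) = 0 := by
    intro j hj k
    induction k with
    | zero =>
      refine fun _ => (hzv (⟨0, by omega⟩, ⟨j, by omega⟩)).trans (hbd _ ⟨nodePt_mem_OmegaCl hh _, ?_⟩)
      intro hO
      have := hO.1.1
      simp [nodePt, vertexPt] at this
    | succ k ih => exact fun hk => (hstep k j hk hj).trans (ih (by omega))
  funext i
  by_cases hi : (i.2 : ℕ) < h
  · rw [← hzv i, hzero _ hi _ i.1.is_le, Pi.zero_apply]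
  · refine hbd i ⟨nodePt_mem_OmegaCl hh i, fun hO => ?_⟩
    have := hO.2.2
    rw [nodePt, vertexPt, vtx_one, div_lt_one h0] at this
    exact hi (by exact_mod_cast this)

end Energy

section DiscreteEnergy

open Set Topology Matrix

variable {h : ℕ}

/-- Nodal values of the coefficient `v² + η`. -/
noncomputable def degradation (η : ℝ) (b : Node h → ℝ) : Node h → ℝ := fun i => b i ^ 2 + η

/-- The part of the energy depending only on the nodal values of the phase field. -/
noncomputable def phaseEnergy (b : Node h → ℝ) : ℝ :=
  1 / 2 * (b ⬝ᵥ stiffness 1 *ᵥ b) + 1 / 2 * ∫ x in Omega, nodalFn (fun i => (1 - b i) ^ 2) x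

lemma degradation_pos {η : ℝ} (hη : 0 < η) (b : Node h → ℝ) (i : Node h) :
    0 < degradation η b i := by
  rw [degradation]
  positivity

lemma sup_zero_sq_le (r : ℝ) : (r ⊔ 0) ^ 2 ≤ r ^ 2 := by
  rcases le_total r 0 with hr | hr
  · rw [sup_eq_right.2 hr, zero_pow two_ne_zero]
    exact sq_nonneg r
  · rw [sup_eq_left.2 hr]

lemma one_sub_sup_zero_sq_le (r : ℝ) : (1 - r ⊔ 0) ^ 2 ≤ (1 - r) ^ 2 := by
  rcases le_total r 0 with hr | hr
  · rw [sup_eq_right.2 hr]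
    nlinarith
  · rw [sup_eq_left.2 hr]

lemma continuous_degradation (η : ℝ) : Continuous (degradation η : (Node h → ℝ) → _) := by
  unfold degradation
  fun_prop

lemma degradation_sup_zero_le (η : ℝ) (b : Node h → ℝ) :
    degradation η (b ⊔ 0) ≤ degradation η b :=
  fun i => by simpa [degradation] using sup_zero_sq_le (b i)

lemma continuous_phaseEnergy : Continuous (phaseEnergy : (Node h → ℝ) → ℝ) := by
  have hint : ∀ c : Node h → ℝ, ∫ x in Omega, nodalFn c x = ∑ i, c i * ∫ x in Omega, hat i x := by
    intro c
    simp only [nodalFn]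
    rw [integral_finsetSum _ fun i _ => (integrable_hat i).const_mul (c i)]
    simp only [integral_const_mul]
  unfold phaseEnergy
  simp only [hint, dotProduct, mulVec]
  fun_prop

lemma phaseEnergy_sup_zero_le (hh : 1 ≤ h) (b : Node h → ℝ) :
    phaseEnergy (b ⊔ 0) ≤ phaseEnergy b := by
  refine add_le_add (mul_le_mul_of_nonneg_left (stiffness_sup_zero_le hh zero_le_one b)
    one_half_pos.le) (mul_le_mul_of_nonneg_left (integral_mono (integrable_nodalFn _)
      (integrable_nodalFn _) (nodalFn_mono fun i => ?_)) one_half_pos.le)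
  exact one_sub_sup_zero_sq_le (b i)

lemma nodalFn_degradation (hh : 1 ≤ h) (η : ℝ) (v : E2 → ℝ) {x : E2} (hx : x ∈ OmegaCl) :
    nodalFn (degradation η (nodalVal h v)) x = Ph h (fun y => v y ^ 2) x + η := by
  have h1 := nodalFn_one hh hx
  rw [Ph_eq hh _ hx]
  simp only [nodalFn, Pi.one_apply, one_mul] at h1 ⊢
  simp only [degradation, add_mul, Finset.sum_add_distrib, ← Finset.mul_sum, h1, mul_one]
  rfl

lemma integral_power_eq (hh : 1 ≤ h) (η : ℝ) {u v w : E2 → ℝ} (hu : MemF h u) (hw : MemF h w) :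
    ∫ x in Omega, (Ph h (fun y => v y ^ 2) x + η) * ⟪grad u x, grad w x⟫ =
      nodalVal h u ⬝ᵥ stiffness (degradation η (nodalVal h v)) *ᵥ nodalVal h w := by
  rw [dotProduct_stiffness]
  refine setIntegral_congr_fun measurableSet_Omega fun x hx => ?_
  rw [nodalFn_degradation hh η v (Omega_subset_OmegaCl hx), hu.grad_eq hh hx, hw.grad_eq hh hx]

lemma Jh_eq (hh : 1 ≤ h) (η : ℝ) {u v : E2 → ℝ} (hu : MemF h u) (hv : MemF h v) :
    Jh h η u v = 1 / 2 * (nodalVal h u ⬝ᵥ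
      stiffness (degradation η (nodalVal h v)) *ᵥ nodalVal h u) + phaseEnergy (nodalVal h v) := by
  rw [Jh, phaseEnergy, ← integral_power_eq hh η hu hu, dotProduct_stiffness, ← add_assoc]
  simp only [real_inner_self_eq_norm_sq]
  congr 2
  · congr 1
    refine setIntegral_congr_fun measurableSet_Omega fun x hx => ?_
    rw [nodalFn_one hh (Omega_subset_OmegaCl hx), one_mul, hv.grad_eq hh hx]
  · exact setIntegral_congr_fun measurableSet_Omega fun x hx =>
      Ph_eq hh _ (Omega_subset_OmegaCl hx)

lemma memF_zero : MemF h fun _ => 0 :=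
  ⟨continuousOn_const, fun _ _ _ _ _ _ => ⟨⟨0, 0, by simp⟩, ⟨0, 0, by simp⟩⟩⟩

lemma nodalVal_mem_Icc (hh : 1 ≤ h) {v : E2 → ℝ} (hv : MemF h v)
    (hv01 : ∀ x ∈ Omega, 0 ≤ v x ∧ v x ≤ 1) : nodalVal h v ∈ Icc (0 : Node h → ℝ) 1 :=
  ⟨nodalVal_le_of_le hh memF_zero hv fun x hx => (hv01 x hx).1,
    nodalVal_le_of_le hh hv memF_one fun x hx => (hv01 x hx).2⟩

end DiscreteEnergy

/-- (Existence of finite-dimensional quasi-static evolutions, Theorem 1.)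
Given `T > 0`, a boundary datum `w ∈ W^{1,2}([0,T]; 𝔽_h)` (with a.e. derivative `w'`), and
initial data `u₀ ∈ 𝔄_h(w(0))`, `v₀ ∈ 𝔽_h` with `0 ≤ v₀ ≤ 1` on `Ω`, there exists a
finite-dimensional quasi-static evolution `(u, v)` with `u(0) = u₀`, `v(0) = v₀`:
(i) irreversibility; (ii) stability for `t ∈ (0, T]`; (iii) the energy-dissipation
inequality on `[0, T]`. -/
theorem statement14 (h : ℕ) (hh : 1 ≤ h) (η : ℝ) (hη : 0 < η)
    (T : ℝ) (hT : 0 < T)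
    (w w' : ℝ → E2 → ℝ)
    (hwmem : ∀ t ∈ Set.Icc (0:ℝ) T, MemF h (w t))
    (hw'mem : ∀ t ∈ Set.Icc (0:ℝ) T, MemF h (w' t))
    (hw'int : ∀ x ∈ OmegaCl, IntegrableOn (fun s => w' s x) (Set.Icc (0:ℝ) T))
    (hAC : ∀ t ∈ Set.Icc (0:ℝ) T, ∀ x ∈ OmegaCl,
      w t x = w 0 x + ∫ s in Set.Ioc (0:ℝ) t, w' s x)
    (hw'L2 : IntegrableOn (fun s => H1normSq (w' s)) (Set.Icc (0:ℝ) T))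
    (u0 v0 : E2 → ℝ) (hu0 : MemA h (w 0) u0) (hv0 : MemF h v0)
    (hv001 : ∀ x ∈ Omega, 0 ≤ v0 x ∧ v0 x ≤ 1) :
    ∃ u v : ℝ → E2 → ℝ,
      u 0 = u0 ∧ v 0 = v0 ∧
      (∀ t ∈ Set.Icc (0:ℝ) T, MemF h (u t) ∧ MemF h (v t)) ∧
      (∀ s t : ℝ, 0 ≤ s → s ≤ t → t ≤ T →
        ∀ x ∈ Omega, 0 ≤ v t x ∧ v t x ≤ v s x ∧ v s x ≤ 1) ∧
      (∀ t : ℝ, 0 < t → t ≤ T →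
        MemA h (w t) (u t) ∧
        (∀ u', MemA h (w t) u' → Jh h η (u t) (v t) ≤ Jh h η u' (v t)) ∧
        (∀ v', MemF h v' → (∀ x ∈ Omega, v' x ≤ v t x) →
          Jh h η (u t) (v t) ≤ Jh h η (u t) v')) ∧
      (∀ t ∈ Set.Icc (0:ℝ) T,
        Jh h η (u t) (v t) ≤ Jh h η u0 v0
          + ∫ s in Set.Ioc (0:ℝ) t, ∫ x in Omega,
              (Ph h (fun y => (v s y)^2) x + η) * ⟪grad (u s) x, grad (w' s) x⟫) := by
  let bd : Set (Node h) := {i | nodePt i ∈ OmegaBd}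
  have hg : ∀ i : Node h, IsPrimitiveOn T (fun t => nodalVal h (w t) i)
      (fun t => nodalVal h (w' t) i) := fun i =>
    ⟨hw'int _ (nodePt_mem_OmegaCl hh i), fun t ht => hAC t ht _ (nodePt_mem_OmegaCl hh i)⟩
  obtain ⟨a, b, hb0, hanti, hb01, habd, hamin, hbmin, henergy⟩ :=
    exists_quadratic_evolution (bd := bd) hT (D := phaseEnergy)
      (Q := fun b => stiffness (degradation η b))
      continuous_phaseEnergy (continuous_stiffness.comp (continuous_degradation η))
      (fun b => isSymm_stiffness _)
      (fun b => stiffness_nonneg fun i => (degradation_pos hη b i).le)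
      (fun b z hz => eq_zero_of_stiffness_eq_zero hh (degradation_pos hη b) hz)
      (phaseEnergy_sup_zero_le hh) (fun b => stiffness_mono (degradation_sup_zero_le η b)) hg
      (a₀ := nodalVal h u0) (b₀ := nodalVal h v0)
      ((memA_iff hh (hwmem 0 ⟨le_rfl, hT.le⟩) hu0.1).1 hu0) (nodalVal_mem_Icc hh hv0 hv001)
  let u : ℝ → E2 → ℝ := fun t => if t = 0 then u0 else nodalFn (a t)
  let v : ℝ → E2 → ℝ := fun t => if t = 0 then v0 else nodalFn (b t)
  have hupos : ∀ t, 0 < t → u t = nodalFn (a t) := fun t ht => if_neg ht.ne'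
  have hu_zero : u 0 = u0 := if_pos rfl
  have hv_zero : v 0 = v0 := if_pos rfl
  have hu : ∀ t, MemF h (u t) := fun t => by
    by_cases ht : t = 0
    · rw [ht, hu_zero]
      exact hu0.1
    · simpa only [u, if_neg ht] using memF_nodalFn hh (a t)
  have hv : ∀ t, MemF h (v t) := fun t => by
    by_cases ht : t = 0
    · rw [ht, hv_zero]
      exact hv0
    · simpa only [v, if_neg ht] using memF_nodalFn hh (b t)
  have hub : ∀ t, 0 < t → nodalVal h (u t) = a t := fun t ht => by
    rw [hupos t ht, nodalVal_nodalFn hh]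
  have hvb : ∀ t, nodalVal h (v t) = b t := fun t => by
    by_cases ht : t = 0
    · rw [ht, hv_zero, hb0]
    · simp only [v, if_neg ht, nodalVal_nodalFn hh]
  have hveq : ∀ t, ∀ x ∈ Omega, v t x = nodalFn (b t) x := fun t x hx => by
    rw [(hv t).eqOn_nodalFn hh (Omega_subset_OmegaCl hx), hvb]
  refine ⟨u, v, hu_zero, hv_zero, fun t _ => ⟨hu t, hv t⟩, ?_, ?_, ?_⟩
  · intro s t _ hst _ x hx
    rw [hveq s x hx, hveq t x hx]
    refine ⟨nodalFn_nonneg (hb01 t).1 x, nodalFn_mono (hanti hst) x, ?_⟩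
    rw [← nodalFn_one hh (Omega_subset_OmegaCl hx)]
    exact nodalFn_mono (hb01 s).2 x
  · intro t ht htT
    have hwt := hwmem t ⟨ht.le, htT⟩
    refine ⟨(memA_iff hh hwt (hu t)).2 ?_, fun u' hu' => ?_, fun v' hv' hle => ?_⟩
    · rw [hub t ht]
      exact habd t
    · rw [Jh_eq hh η (hu t) (hv t), Jh_eq hh η hu'.1 (hv t), hub t ht, hvb]
      exact hamin t _ ((memA_iff hh hwt hu'.1).1 hu')
    · have hle' := nodalVal_le_of_le hh hv' (hv t) hle
      rw [hvb] at hle'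
      rw [Jh_eq hh η (hu t) (hv t), Jh_eq hh η (hu t) hv', hub t ht, hvb]
      exact hbmin t ⟨ht, htT⟩ _ hle'
  · intro t ht
    rcases ht.1.eq_or_lt with rfl | ht0
    · simp [hu_zero, hv_zero]
    · have hpower : ∫ s in Set.Ioc (0 : ℝ) t, ∫ x in Omega,
            (Ph h (fun y => (v s y) ^ 2) x + η) * ⟪grad (u s) x, grad (w' s) x⟫ =
          ∫ s in Set.Ioc (0 : ℝ) t,
            dotProduct (a s) ((stiffness (degradation η (b s))).mulVec (nodalVal h (w' s))) :=
        setIntegral_congr_fun measurableSet_Ioc fun s hs => by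
          beta_reduce
          rw [integral_power_eq hh η (hu s) (hw'mem s ⟨hs.1.le, hs.2.trans ht.2⟩), hub s hs.1, hvb]
      rw [hpower, Jh_eq hh η (hu t) (hv t), Jh_eq hh η hu0.1 hv0, hub t ht0, hvb]
      exact henergy t ht
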